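/- Theorem 4 (non-adaptive protocol with imperfect match): (i) The i.i.d. state ρ = (|G⟩⟨G|)^{⊗(N+1)} passes the N-random sampling test of Ω̄_h(𝒜) with acceptance probability at least (1 − (1/h) sin²(π/(4h)))^{N · max_{1≤l≤m}|A_l|}. (ii) Assume β ≥ 1/(N+1). For every state ρ on ((ℂ²)^{⊗n})^{⊗(N+1)} whose acceptance probability p for the N-random sampling test of Ω̄_h(𝒜) satisfies p ≥ β, the conditional state σ of the remaining copy satisfies ⟨G|σ|G⟩ ≥ 1 − [mh(1−β)/(βN) + n sin(π/(4h))]. -/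

import Mathlib

open scoped BigOperators ComplexOrder
open Matrix Complex

noncomputable section

/-- Computational-basis index set of `(ℂ²)^{⊗n}`. -/
abbrev QIdx (n : ℕ) := Fin n → Fin 2

/-- Linear operators on `(ℂ²)^{⊗n}`, represented as matrices. -/
abbrev QOp (n : ℕ) := Matrix (QIdx n) (QIdx n) ℂ

/-- A bit viewed as a real number. -/
def bR (b : Fin 2) : ℝ := (b : ℕ)

/-- The ℓ²→ℓ² operator norm of a matrix. -/
noncomputable def opNorm {ι : Type*} [Fintype ι] [DecidableEq ι] (M : Matrix ι ι ℂ) : ℝ :=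
  ‖Matrix.toEuclideanCLM (𝕜 := ℂ) M‖

/-- The weighted graph state `|G⟩`, as amplitudes
`⟨z|G⟩ = 2^{-n/2} ∏_{j<k} e^{i θ_{jk} z_j z_k}` (for symmetric `θ`,
`∑_{j<k} = (1/2) ∑_{j,k}`). -/
noncomputable def gVec (n : ℕ) (θ : Fin n → Fin n → ℝ) : QIdx n → ℂ :=
  fun z => ((Real.sqrt (2 ^ n))⁻¹ : ℝ) *
    Complex.exp (Complex.I * ((1 / 2 * ∑ j, ∑ k, θ j k * bR (z j) * bR (z k) : ℝ) : ℂ))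

/-- The rank-one projection `|G⟩⟨G|`. -/
noncomputable def gProj (n : ℕ) (θ : Fin n → Fin n → ℝ) : QOp n :=
  Matrix.vecMulVec (gVec n θ) (star (gVec n θ))

/-- `α_k(z) = ∑_{j ∈ C_k} θ_{jk} z_j` (using `θ_{jk} = 0` on non-edges). -/
noncomputable def alphaAngle (n : ℕ) (θ : Fin n → Fin n → ℝ) (k : Fin n) (z : QIdx n) : ℝ :=
  ∑ j, θ j k * bR (z j)

/-- The discretization `α ↦ α^h`, the unique point `jπ/h` with
`jπ/h - π/(2h) ≤ α < jπ/h + π/(2h)`. -/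
noncomputable def alphaH (h : ℕ) (α : ℝ) : ℝ :=
  (⌊(h : ℝ) * α / Real.pi + 1 / 2⌋ : ℤ) * Real.pi / h

/-- Matrix entry `⟨b|α⟩⟨α|b'⟩ = (1/2) e^{iα(b-b')}` of the projection onto
`|α⟩ = (|0⟩ + e^{iα}|1⟩)/√2`. -/
noncomputable def phaseFac (α : ℝ) (b b' : Fin 2) : ℂ :=
  (1 / 2 : ℂ) * Complex.exp (Complex.I * ((α * (bR b - bR b') : ℝ) : ℂ))

/-- The projection `P_l = ∏_{k ∈ A_l} Q_k`, written out entrywise: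
`P_l = ∑_z (⊗_{k∈A_l} |α_k(z)⟩⟨α_k(z)|) ⊗ |z⟩⟨z|_{A_l^c}`. -/
noncomputable def Pop (n : ℕ) (θ : Fin n → Fin n → ℝ) (A : Finset (Fin n)) : QOp n :=
  Matrix.of fun x y =>
    if ∀ j ∉ A, x j = y j then ∏ k ∈ A, phaseFac (alphaAngle n θ k x) (x k) (y k) else 0

/-- The test operator `Ω(𝒜) = (1/m) ∑_l P_l`. -/
noncomputable def OmegaA (n m : ℕ) (θ : Fin n → Fin n → ℝ) (A : Fin m → Finset (Fin n)) :
    QOp n :=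
  (m : ℂ)⁻¹ • ∑ l, Pop n θ (A l)

/-- The discretized projection `P_{l;h}` (replace `α_k(z)` by `α_k^h(z)`). -/
noncomputable def PopH (n : ℕ) (θ : Fin n → Fin n → ℝ) (h : ℕ) (A : Finset (Fin n)) : QOp n :=
  Matrix.of fun x y =>
    if ∀ j ∉ A, x j = y j then
      ∏ k ∈ A, phaseFac (alphaH h (alphaAngle n θ k x)) (x k) (y k) else 0

/-- The discretized test operator `Ω_h(𝒜) = (1/m) ∑_l P_{l;h}`. -/
noncomputable def OmegaAH (n m : ℕ) (θ : Fin n → Fin n → ℝ) (h : ℕ)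
    (A : Fin m → Finset (Fin n)) : QOp n :=
  (m : ℂ)⁻¹ • ∑ l, PopH n θ h (A l)

/-- Entry of the single-site operator `(1/h) |α⟩⟨α| + (1 - 1/h) I`. -/
noncomputable def mixFac (h : ℕ) (α : ℝ) (b b' : Fin 2) : ℂ :=
  (1 - (h : ℂ)⁻¹) * (if b = b' then 1 else 0) + (h : ℂ)⁻¹ * phaseFac α b b'

/-- `P̄_l = ∏_{k ∈ A_l} ((1/h(k)) Q_k + (1 - 1/h(k)) I)`, written out entrywise. -/
noncomputable def PBar (n : ℕ) (θ : Fin n → Fin n → ℝ) (hf : Fin n → ℕ) (A : Finset (Fin n)) :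
    QOp n :=
  Matrix.of fun x y =>
    if ∀ j ∉ A, x j = y j then ∏ k ∈ A, mixFac (hf k) (alphaAngle n θ k x) (x k) (y k) else 0

/-- `Ω̄(𝒜)_𝐡 = (1/m) ∑_l P̄_l`. -/
noncomputable def OmegaBar (n m : ℕ) (θ : Fin n → Fin n → ℝ) (hf : Fin n → ℕ)
    (A : Fin m → Finset (Fin n)) : QOp n :=
  (m : ℂ)⁻¹ • ∑ l, PBar n θ hf (A l)

/-- `P̄_{l;h} = ∏_{k ∈ A_l} ((1/h) Q_{k;h} + (1 - 1/h) I)`, written out entrywise. -/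
noncomputable def PBarH (n : ℕ) (θ : Fin n → Fin n → ℝ) (h : ℕ) (A : Finset (Fin n)) : QOp n :=
  Matrix.of fun x y =>
    if ∀ j ∉ A, x j = y j then
      ∏ k ∈ A, mixFac h (alphaH h (alphaAngle n θ k x)) (x k) (y k) else 0

/-- `Ω̄_h(𝒜) = (1/m) ∑_l P̄_{l;h}`. -/
noncomputable def OmegaBarH (n m : ℕ) (θ : Fin n → Fin n → ℝ) (h : ℕ)
    (A : Fin m → Finset (Fin n)) : QOp n :=
  (m : ℂ)⁻¹ • ∑ l, PBarH n θ h (A l)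

/-- Index set for `N+1` copies of the `n`-qubit space. -/
abbrev BIdx (n N : ℕ) := Fin (N + 1) → QIdx n

/-- `(⊗_{j ≠ i} Ω) ⊗ I_i` acting on the `N+1` copies. -/
noncomputable def testAll (n N : ℕ) (Ω : QOp n) (i : Fin (N + 1)) :
    Matrix (BIdx n N) (BIdx n N) ℂ :=
  Matrix.of fun x y =>
    (if x i = y i then 1 else 0) * ∏ j ∈ Finset.univ.erase i, Ω (x j) (y j)

/-- Acceptance probability `p = (1/(N+1)) ∑_i Tr[((⊗_{j≠i} Ω) ⊗ I_i) ρ]` of the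
`N`-random sampling test of `Ω` on a state `ρ` of `N+1` copies. -/
noncomputable def acceptProb (n N : ℕ) (Ω : QOp n) (ρ : Matrix (BIdx n N) (BIdx n N) ℂ) : ℝ :=
  (((N : ℂ) + 1)⁻¹ * ∑ i, (testAll n N Ω i * ρ).trace).re

/-- Partial trace over all copies except copy `i`. -/
noncomputable def ptraceAt (n N : ℕ) (i : Fin (N + 1))
    (M : Matrix (BIdx n N) (BIdx n N) ℂ) : QOp n :=
  Matrix.of fun a b => ∑ x : BIdx n N, if x i = a then M x (Function.update x i b) else 0

/-- The conditional state of the remaining copy given that the test is passed: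
`σ = (1/((N+1)p)) ∑_i Tr_{j≠i}[((⊗_{j≠i} Ω) ⊗ I_i) ρ]`. -/
noncomputable def condState (n N : ℕ) (Ω : QOp n) (ρ : Matrix (BIdx n N) (BIdx n N) ℂ) :
    QOp n :=
  (((((N : ℝ) + 1) * acceptProb n N Ω ρ : ℝ) : ℂ))⁻¹ •
    ∑ i, ptraceAt n N i (testAll n N Ω i * ρ)

/-- The i.i.d. state `(|G⟩⟨G|)^{⊗(N+1)}`. -/
noncomputable def iidState (n N : ℕ) (θ : Fin n → Fin n → ℝ) :
    Matrix (BIdx n N) (BIdx n N) ℂ :=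
  Matrix.of fun x y => ∏ j, gVec n θ (x j) * star (gVec n θ (y j))


/-! ### Tensor products of matrices -/
section Helpers

set_option linter.unusedSectionVars false
set_option linter.unusedSimpArgs false

open scoped MatrixOrder

/-- Tensor product of a family of matrices. -/
def tens {ι κ : Type*} [Fintype ι] (M : ι → Matrix κ κ ℂ) : Matrix (ι → κ) (ι → κ) ℂ :=
  Matrix.of fun x y => ∏ j, M j (x j) (y j)

section tensLemmas
variable {ι κ : Type*} [Fintype ι] [DecidableEq ι] [Fintype κ] [DecidableEq κ]

theorem tens_apply (M : ι → Matrix κ κ ℂ) (x y : ι → κ) :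
    tens M x y = ∏ j, M j (x j) (y j) := rfl

theorem tens_mul (M M' : ι → Matrix κ κ ℂ) : tens M * tens M' = tens (fun k => M k * M' k) := by
  ext x y
  simp only [Matrix.mul_apply, tens_apply]
  rw [Finset.prod_univ_sum]
  simp [Finset.prod_mul_distrib]

theorem tens_conjTranspose (M : ι → Matrix κ κ ℂ) : (tens M)ᴴ = tens (fun k => (M k)ᴴ) := by
  ext x y
  simp [Matrix.conjTranspose_apply, tens_apply]

theorem tens_diagonal (d : ι → κ → ℂ) :
    tens (fun k => Matrix.diagonal (d k)) = Matrix.diagonal (fun x => ∏ k, d k (x k)) := by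
  ext x y
  rw [tens_apply]
  by_cases hxy : x = y
  · subst hxy; simp
  · rw [Matrix.diagonal_apply_ne _ hxy]
    obtain ⟨k, hk⟩ := Function.ne_iff.mp hxy
    exact Finset.prod_eq_zero (Finset.mem_univ k) (Matrix.diagonal_apply_ne _ hk)

theorem tens_one : tens (fun _ : ι => (1 : Matrix κ κ ℂ)) = 1 := by
  have := tens_diagonal (fun (_ : ι) (_ : κ) => (1 : ℂ))
  simpa using this

theorem tens_trace (M : ι → Matrix κ κ ℂ) : (tens M).trace = ∏ k, (M k).trace := by
  simp only [Matrix.trace, Matrix.diag_apply, tens_apply]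
  rw [Finset.prod_univ_sum]
  simp

theorem tens_sum (M : ι → Matrix κ κ ℂ) :
    ∑ x, ∑ y, tens M x y = ∏ k, ∑ a, ∑ b, M k a b := by
  simp only [tens_apply]
  rw [Finset.prod_univ_sum]
  simp only [Fintype.piFinset_univ]
  refine Finset.sum_congr rfl fun x _ => ?_
  rw [Finset.prod_univ_sum]
  simp

theorem tens_spec (U : ι → Matrix κ κ ℂ) (d : ι → κ → ℂ) :
    tens (fun k => U k * Matrix.diagonal (d k) * (U k)ᴴ) =
      tens U * Matrix.diagonal (fun x => ∏ k, d k (x k)) * (tens U)ᴴ := by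
  rw [tens_conjTranspose, ← tens_diagonal, tens_mul, tens_mul]

theorem tens_nonneg (M : ι → Matrix κ κ ℂ) (hM : ∀ k, (M k).PosSemidef) :
    (tens M).PosSemidef := by
  have : M = fun k => ((hM k).1.eigenvectorUnitary : Matrix κ κ ℂ) *
      Matrix.diagonal (fun a => (((hM k).1.eigenvalues a : ℝ) : ℂ)) *
      ((hM k).1.eigenvectorUnitary : Matrix κ κ ℂ)ᴴ := by
    funext k
    conv_lhs => rw [(hM k).1.spectral_theorem, Unitary.conjStarAlgAut_apply]
    rfl
  rw [this, tens_spec]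
  refine Matrix.PosSemidef.mul_mul_conjTranspose_same ?_ _
  refine Matrix.PosSemidef.diagonal fun x => ?_
  refine Finset.prod_nonneg fun k _ => ?_
  exact Complex.zero_le_real.mpr ((hM k).eigenvalues_nonneg _)

theorem tens_update (M : ι → Matrix κ κ ℂ) (k : ι) (X : Matrix κ κ ℂ) (x y : ι → κ) :
    tens (Function.update M k X) x y =
      X (x k) (y k) * ∏ j ∈ Finset.univ.erase k, M j (x j) (y j) := by
  rw [tens_apply, ← Finset.mul_prod_erase _ _ (Finset.mem_univ k)]
  simp only [Function.update_self]
  congr 1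
  refine Finset.prod_congr rfl fun j hj => ?_
  rw [Function.update_of_ne (Finset.ne_of_mem_erase hj)]

theorem tens_update_sub (M : ι → Matrix κ κ ℂ) (k : ι) (X Y : Matrix κ κ ℂ) :
    tens (Function.update M k (X - Y)) =
      tens (Function.update M k X) - tens (Function.update M k Y) := by
  ext x y
  simp only [tens_update, Matrix.sub_apply]
  ring

theorem tens_update_add (M : ι → Matrix κ κ ℂ) (k : ι) (X Y : Matrix κ κ ℂ) :
    tens (Function.update M k (X + Y)) =
      tens (Function.update M k X) + tens (Function.update M k Y) := by
  ext x y
  simp only [tens_update, Matrix.add_apply]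
  ring

theorem tens_update_smul (M : ι → Matrix κ κ ℂ) (k : ι) (c : ℂ) (X : Matrix κ κ ℂ) :
    tens (Function.update M k (c • X)) = c • tens (Function.update M k X) := by
  ext x y
  simp only [tens_update, Matrix.smul_apply, smul_eq_mul]
  ring

theorem tens_update_mono (M : ι → Matrix κ κ ℂ) (k : ι) (X Y : Matrix κ κ ℂ) 
    (hM : ∀ j, 0 ≤ M j) (hXY : X ≤ Y) :
    tens (Function.update M k X) ≤ tens (Function.update M k Y) := by
  rw [Matrix.le_iff, ← tens_update_sub]
  refine tens_nonneg _ fun j => ?_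
  rcases eq_or_ne j k with rfl | hj
  · simpa [Matrix.le_iff] using hXY
  · rw [Function.update_of_ne hj]
    exact Matrix.nonneg_iff_posSemidef.mp (hM j)

theorem tens_mono (a b : ι → Matrix κ κ ℂ) (ha : ∀ k, 0 ≤ a k) (hab : ∀ k, a k ≤ b k) :
    tens a ≤ tens b := by
  have key : ∀ S : Finset ι, tens a ≤ tens (fun k => if k ∈ S then b k else a k) := by
    intro S
    induction S using Finset.induction_on with
    | empty => simp
    | insert k S hk ih =>
      refine ih.trans ?_
      set M : ι → Matrix κ κ ℂ := fun k => if k ∈ S then b k else a k with hMdef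
      have h1 : M = Function.update M k (a k) := by
        rw [eq_comm, Function.update_eq_self_iff]; simp [M, hk]
      have h2 : (fun j => if j ∈ insert k S then b j else a j) = Function.update M k (b k) := by
        funext j
        rcases eq_or_ne j k with rfl | hj
        · simp
        · simp [Function.update_of_ne hj, M, hj]
      rw [h2]
      conv_lhs => rw [h1]
      refine tens_update_mono _ _ _ _ (fun j => ?_) (hab k)
      simp only [M]
      split_ifs
      · exact (ha j).trans (hab j)
      · exact ha j
  simpa using key Finset.univ

theorem tens_diff (a b e : ι → Matrix κ κ ℂ) (c : ι → ℝ) (hc : ∀ k, 0 ≤ c k)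
    (ha : ∀ k, 0 ≤ a k) (hb : ∀ k, 0 ≤ b k) (hae : ∀ k, a k ≤ e k) (hbe : ∀ k, b k ≤ e k)
    (hab : ∀ k, a k - b k ≤ (c k : ℂ) • e k) :
    tens a - tens b ≤ ((∑ k, c k : ℝ) : ℂ) • tens e := by
  have key : ∀ S : Finset ι, tens (fun k => if k ∈ S then a k else b k) - tens b ≤
      ((∑ k ∈ S, c k : ℝ) : ℂ) • tens e := by
    intro S
    induction S using Finset.induction_on with
    | empty => simp
    | insert k S hk ih =>
      set M : ι → Matrix κ κ ℂ := fun k => if k ∈ S then a k else b k with hMdef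
      have hM0 : ∀ j, 0 ≤ M j := by
        intro j; simp only [M]; split_ifs
        · exact ha j
        · exact hb j
      have hMe : ∀ j, M j ≤ e j := by
        intro j; simp only [M]; split_ifs
        · exact hae j
        · exact hbe j
      have h1 : M = Function.update M k (b k) := by
        rw [eq_comm, Function.update_eq_self_iff]; simp [M, hk]
      have h2 : (fun j => if j ∈ insert k S then a j else b j) = Function.update M k (a k) := by
        funext j
        rcases eq_or_ne j k with rfl | hj
        · simp
        · simp [Function.update_of_ne hj, M, hj]
      have h3 : tens (Function.update M k (a k)) - tens M ≤ (c k : ℂ) • tens e := by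
        have h4 : tens (Function.update M k (a k)) - tens M =
            tens (Function.update M k (a k - b k)) := by
          rw [tens_update_sub, ← h1]
        rw [h4]
        refine (tens_update_mono M k _ _ hM0 (hab k)).trans ?_
        rw [tens_update_smul, Matrix.le_iff, ← smul_sub]
        refine Matrix.PosSemidef.smul ?_ (by exact_mod_cast hc k)
        rw [← Matrix.le_iff]
        refine tens_mono _ _ (fun j => ?_) (fun j => ?_)
        · rcases eq_or_ne j k with rfl | hj
          · simpa using (ha j).trans (hae j)
          · rw [Function.update_of_ne hj]; exact hM0 j
        · rcases eq_or_ne j k with rfl | hj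
          · simp
          · rw [Function.update_of_ne hj]; exact hMe j
      rw [h2, Finset.sum_insert hk]
      have h5 := add_le_add h3 ih
      rw [Complex.ofReal_add, add_smul]
      refine le_trans (le_of_eq ?_) h5
      abel
  simpa using key Finset.univ

theorem trace_mul_re_nonneg {X ρ : Matrix κ κ ℂ} (hX : X.PosSemidef) (hρ : ρ.PosSemidef) :
    0 ≤ (X * ρ).trace.re := by
  have e1 : X = (hX.1.eigenvectorUnitary : Matrix κ κ ℂ) *
      Matrix.diagonal (fun a => ((hX.1.eigenvalues a : ℝ) : ℂ)) *
      (hX.1.eigenvectorUnitary : Matrix κ κ ℂ)ᴴ := by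
    conv_lhs => rw [hX.1.spectral_theorem, Unitary.conjStarAlgAut_apply]
    rfl
  rw [e1, mul_assoc, Matrix.trace_mul_comm, ← mul_assoc, Matrix.trace_mul_comm]
  have h2 := hρ.conjTranspose_mul_mul_same (hX.1.eigenvectorUnitary : Matrix κ κ ℂ)
  simp only [Matrix.mul_assoc] at h2 ⊢
  simp only [Matrix.trace, Matrix.diag_apply, Matrix.diagonal_mul, Complex.re_sum]
  refine Finset.sum_nonneg fun i _ => ?_
  have h3 := h2.diag_nonneg (i := i)
  rw [Complex.le_def] at h3
  rw [Complex.re_ofReal_mul]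
  exact mul_nonneg (hX.eigenvalues_nonneg i) h3.1

theorem scalar_ineq (l : ι → ℝ) (h0 : ∀ i, 0 ≤ l i) (h1 : ∀ i, l i ≤ 1) (S : Finset ι) :
    ∑ i ∈ S, ∏ j ∈ S.erase i, l j ≤ 1 + ((S.card : ℝ) - 1) * ∏ j ∈ S, l j := by
  induction S using Finset.induction_on with
  | empty => simp
  | insert a S ha ih =>
    rw [Finset.sum_insert ha, Finset.erase_insert ha, Finset.prod_insert ha,
      Finset.card_insert_of_notMem ha]
    have e : ∑ i ∈ S, ∏ j ∈ (insert a S).erase i, l j = l a * ∑ i ∈ S, ∏ j ∈ S.erase i, l j := by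
      rw [Finset.mul_sum]
      refine Finset.sum_congr rfl fun i hi => ?_
      have hne : a ≠ i := fun h => ha (h ▸ hi)
      rw [Finset.erase_insert_of_ne hne, Finset.prod_insert]
      exact fun h => ha (Finset.mem_of_mem_erase h)
    rw [e]
    have hP0 : 0 ≤ ∏ j ∈ S, l j := Finset.prod_nonneg fun j _ => h0 j
    have hP1 : ∏ j ∈ S, l j ≤ 1 := Finset.prod_le_one (fun j _ => h0 j) fun j _ => h1 j
    have h3 := mul_le_mul_of_nonneg_left ih (h0 a)
    push_cast
    nlinarith [mul_nonneg (sub_nonneg.mpr (h1 a)) (sub_nonneg.mpr hP1)]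

theorem tens_ineq (Ω : Matrix κ κ ℂ) (h0 : Ω.PosSemidef) (h1 : (1 - Ω).PosSemidef) :
    (1 + ((Fintype.card ι : ℂ) - 1) • tens (fun _ : ι => Ω) -
      ∑ i : ι, tens (Function.update (fun _ : ι => Ω) i 1)).PosSemidef := by
  set U : Matrix κ κ ℂ := (h0.1.eigenvectorUnitary : Matrix κ κ ℂ) with hU
  set l : κ → ℝ := h0.1.eigenvalues with hl
  have hUU : U * Uᴴ = 1 := by
    exact Unitary.mul_star_self_of_mem h0.1.eigenvectorUnitary.2
  have hUU' : Uᴴ * U = 1 := by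
    exact Unitary.star_mul_self_of_mem h0.1.eigenvectorUnitary.2
  have e1 : Ω = U * Matrix.diagonal (fun a => ((l a : ℝ) : ℂ)) * Uᴴ := by
    conv_lhs => rw [h0.1.spectral_theorem, Unitary.conjStarAlgAut_apply]
    rfl
  have hl0 : ∀ a, 0 ≤ l a := h0.eigenvalues_nonneg
  have hl1 : ∀ a, l a ≤ 1 := by
    intro a
    have h2 := h1.conjTranspose_mul_mul_same U
    have h3 : Uᴴ * (1 - Ω) * U = 1 - Matrix.diagonal (fun a => ((l a : ℝ) : ℂ)) := by
      have h5 : Uᴴ * (U * Matrix.diagonal (fun a => ((l a : ℝ) : ℂ)) * Uᴴ) * U =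
          (Uᴴ * U) * Matrix.diagonal (fun a => ((l a : ℝ) : ℂ)) * (Uᴴ * U) := by
        simp only [Matrix.mul_assoc]
      rw [mul_sub, sub_mul, mul_one, hUU', e1, h5, hUU', one_mul, mul_one]
    rw [h3] at h2
    have h4 := h2.diag_nonneg (i := a)
    rw [Complex.le_def] at h4
    simpa using h4.1
  have t1 : ∀ d : ι → κ → ℂ, tens (fun k => U * Matrix.diagonal (d k) * Uᴴ) =
      tens (fun _ : ι => U) * Matrix.diagonal (fun x => ∏ k, d k (x k)) *
        (tens (fun _ : ι => U))ᴴ := fun d => tens_spec (fun _ => U) d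
  have a1 : (1 : Matrix (ι → κ) (ι → κ) ℂ) = tens (fun _ : ι => U) *
      Matrix.diagonal (fun _ => 1) * (tens (fun _ : ι => U))ᴴ := by
    rw [← tens_one]
    have := t1 (fun _ _ => 1)
    simpa [hUU] using this
  have a2 : tens (fun _ : ι => Ω) = tens (fun _ : ι => U) *
      Matrix.diagonal (fun x => ∏ k, ((l (x k) : ℝ) : ℂ)) * (tens (fun _ : ι => U))ᴴ := by
    have := t1 (fun _ a => ((l a : ℝ) : ℂ))
    rw [← e1] at this
    exact this
  have a3 : ∀ i, tens (Function.update (fun _ : ι => Ω) i 1) = tens (fun _ : ι => U) *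
      Matrix.diagonal (fun x => ∏ k ∈ Finset.univ.erase i, ((l (x k) : ℝ) : ℂ)) *
        (tens (fun _ : ι => U))ᴴ := by
    intro i
    have := t1 (fun k a => if k = i then 1 else ((l a : ℝ) : ℂ))
    have e2 : (fun x : ι → κ => ∏ k, if k = i then (1 : ℂ) else ((l (x k) : ℝ) : ℂ)) =
        fun x => ∏ k ∈ Finset.univ.erase i, ((l (x k) : ℝ) : ℂ) := by
      funext x
      rw [← Finset.mul_prod_erase _ _ (Finset.mem_univ i)]
      simp only [if_true, one_mul]
      refine Finset.prod_congr rfl fun k hk => ?_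
      rw [if_neg (Finset.ne_of_mem_erase hk)]
    rw [e2] at this
    rw [← this]
    congr 1
    funext k
    rcases eq_or_ne k i with rfl | hk
    · simp [hUU]
    · simp [Function.update_of_ne hk, hk, ← e1]
  have fin : 1 + ((Fintype.card ι : ℂ) - 1) • tens (fun _ : ι => Ω) -
      ∑ i : ι, tens (Function.update (fun _ : ι => Ω) i 1) = tens (fun _ : ι => U) *
      Matrix.diagonal (fun x => ((1 + ((Fintype.card ι : ℝ) - 1) * ∏ k, l (x k) -
        ∑ i, ∏ k ∈ Finset.univ.erase i, l (x k) : ℝ) : ℂ)) * (tens (fun _ : ι => U))ᴴ := by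
    rw [a1, a2, Finset.sum_congr rfl (fun i _ => a3 i), ← Finset.sum_mul, ← Finset.mul_sum,
      ← smul_mul_assoc, ← mul_smul_comm, ← add_mul, ← mul_add, ← sub_mul, ← mul_sub]
    congr 2
    ext x y
    by_cases hxy : x = y
    · subst hxy
      simp [Matrix.sum_apply]
    · simp [Matrix.sum_apply, hxy]
  rw [fin]
  refine Matrix.PosSemidef.mul_mul_conjTranspose_same ?_ _
  refine Matrix.PosSemidef.diagonal fun x => ?_
  have := scalar_ineq (fun i : ι => l (x i)) (fun i => hl0 _) (fun i => hl1 _) Finset.univ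
  have h9 : (0 : ℝ) ≤ 1 + ((Fintype.card ι : ℝ) - 1) * ∏ k, l (x k) -
        ∑ i, ∏ k ∈ Finset.univ.erase i, l (x k) := by
    rw [Finset.card_univ] at this
    linarith
  exact Complex.zero_le_real.mpr h9

end tensLemmas

/-! ### Single-qubit operators -/

/-- The single-site operator as a matrix. -/
def mixM (h : ℕ) (α : ℝ) : Matrix (Fin 2) (Fin 2) ℂ := Matrix.of (mixFac h α)

theorem mixM_apply (h : ℕ) (α : ℝ) (a b : Fin 2) : mixM h α a b = mixFac h α a b := rfl

theorem bR_zero : bR 0 = 0 := by simp [bR]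
theorem bR_one : bR 1 = 1 := by simp [bR]

theorem exp_conj_I (t : ℝ) : (starRingEnd ℂ) (Complex.exp (Complex.I * t)) =
    Complex.exp (-(Complex.I * t)) := by
  rw [← Complex.exp_conj]; simp

theorem exp_mul_neg (t : ℂ) : Complex.exp t * Complex.exp (-t) = 1 := by
  rw [← Complex.exp_add]; simp

theorem phase_psd (α : ℝ) : (Matrix.of (phaseFac α)).PosSemidef := by
  have : Matrix.of (phaseFac α) = (1 / 2 : ℂ) • Matrix.vecMulVec
      (fun b : Fin 2 => Complex.exp (Complex.I * ((α * bR b : ℝ) : ℂ)))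
      (star (fun b : Fin 2 => Complex.exp (Complex.I * ((α * bR b : ℝ) : ℂ)))) := by
    ext a b
    simp only [Matrix.of_apply, phaseFac, Matrix.smul_apply, Matrix.vecMulVec_apply,
      Pi.star_apply, smul_eq_mul, Complex.star_def, exp_conj_I]
    rw [← Complex.exp_add]
    congr 2
    push_cast; ring
  rw [this]
  refine Matrix.PosSemidef.smul (Matrix.posSemidef_vecMulVec_self_star _) ?_
  rw [Complex.le_def]; norm_num

theorem one_sub_phase_psd (α : ℝ) : (1 - Matrix.of (phaseFac α)).PosSemidef := by
  have : 1 - Matrix.of (phaseFac α) = (1 / 2 : ℂ) • Matrix.vecMulVec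
      (fun b : Fin 2 => (if b = 0 then 1 else -1) * Complex.exp (Complex.I * ((α * bR b : ℝ) : ℂ)))
      (star (fun b : Fin 2 => (if b = 0 then 1 else -1) *
        Complex.exp (Complex.I * ((α * bR b : ℝ) : ℂ)))) := by
    ext a b
    have := exp_mul_neg (Complex.I * α)
    have := exp_mul_neg (Complex.I * α)
    fin_cases a <;> fin_cases b <;>
      simp [phaseFac, Matrix.vecMulVec_apply, exp_conj_I, bR_zero, bR_one, ← Complex.exp_conj,
        exp_mul_neg] <;> norm_num
  rw [this]
  refine Matrix.PosSemidef.smul (Matrix.posSemidef_vecMulVec_self_star _) ?_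
  rw [Complex.le_def]; norm_num

theorem mixM_eq (h : ℕ) (α : ℝ) :
    mixM h α = (1 - (h : ℂ)⁻¹) • (1 : Matrix (Fin 2) (Fin 2) ℂ) +
      (h : ℂ)⁻¹ • Matrix.of (phaseFac α) := by
  ext a b
  simp [mixM, mixFac, Matrix.one_apply]

theorem hinv_nonneg (h : ℕ) : (0 : ℂ) ≤ (h : ℂ)⁻¹ := by
  have : ((h : ℂ)⁻¹) = (((h : ℝ)⁻¹ : ℝ) : ℂ) := by push_cast; rfl
  rw [this]; exact Complex.zero_le_real.mpr (by positivity)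

theorem hinv_le_one (h : ℕ) (hh : 1 ≤ h) : (0 : ℂ) ≤ 1 - (h : ℂ)⁻¹ := by
  have : (1 - (h : ℂ)⁻¹) = ((1 - (h : ℝ)⁻¹ : ℝ) : ℂ) := by push_cast; rfl
  rw [this]; refine Complex.zero_le_real.mpr (sub_nonneg.mpr (inv_le_one_of_one_le₀ ?_))
  exact_mod_cast hh

theorem mixM_nonneg (h : ℕ) (hh : 1 ≤ h) (α : ℝ) : 0 ≤ mixM h α := by
  rw [Matrix.nonneg_iff_posSemidef, mixM_eq]
  exact (Matrix.PosSemidef.one.smul (hinv_le_one h hh)).add ((phase_psd α).smul (hinv_nonneg h))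

theorem mixM_le_one (h : ℕ) (α : ℝ) : mixM h α ≤ 1 := by
  rw [Matrix.le_iff]
  have : 1 - mixM h α = (h : ℂ)⁻¹ • (1 - Matrix.of (phaseFac α)) := by
    rw [mixM_eq]; module
  rw [this]
  exact (one_sub_phase_psd α).smul (hinv_nonneg h)

theorem phase_diff (s α α' : ℝ) (hs : |Real.sin ((α - α') / 2)| ≤ s) :
    ((s : ℂ) • (1 : Matrix (Fin 2) (Fin 2) ℂ) -
      (Matrix.of (phaseFac α) - Matrix.of (phaseFac α'))).PosSemidef := by
  set σ : ℝ := Real.sin ((α - α') / 2) with hσ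
  obtain ⟨h1, h2⟩ := abs_le.mp hs
  set u : ℂ := Complex.I * Complex.exp (Complex.I * (((α + α') / 2 : ℝ) : ℂ)) with hu
  have huu : u * (starRingEnd ℂ) u = 1 := by
    simp only [hu, map_mul, exp_conj_I, Complex.conj_I]
    linear_combination (-Complex.I ^ 2) * exp_mul_neg (Complex.I * (((α + α') / 2 : ℝ) : ℂ)) - Complex.I_sq
  have hd : (Complex.exp (Complex.I * α) - Complex.exp (Complex.I * α')) / 2 = σ * u := by
    have e1 : Complex.exp (Complex.I * α) = Complex.exp (Complex.I * (((α + α') / 2 : ℝ) : ℂ)) *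
        Complex.exp (((α - α') / 2 : ℝ) * Complex.I) := by
      rw [← Complex.exp_add]; congr 1; push_cast; ring
    have e2 : Complex.exp (Complex.I * α') = Complex.exp (Complex.I * (((α + α') / 2 : ℝ) : ℂ)) *
        Complex.exp (((-((α - α') / 2) : ℝ) : ℂ) * Complex.I) := by
      rw [← Complex.exp_add]; congr 1; push_cast; ring
    rw [e1, e2, Complex.exp_mul_I, Complex.exp_mul_I, hu, hσ]
    rw [← Complex.ofReal_cos, ← Complex.ofReal_cos, ← Complex.ofReal_sin, ← Complex.ofReal_sin,
      Real.cos_neg, Real.sin_neg]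
    push_cast; ring
  have hd' := congrArg (starRingEnd ℂ) hd
  rw [map_div₀, map_sub, exp_conj_I, exp_conj_I, map_mul, Complex.conj_ofReal] at hd'
  simp only [map_ofNat] at hd'
  have : (s : ℂ) • (1 : Matrix (Fin 2) (Fin 2) ℂ) -
      (Matrix.of (phaseFac α) - Matrix.of (phaseFac α')) =
      (((s - σ) / 2 : ℝ) : ℂ) • Matrix.vecMulVec (fun b : Fin 2 => if b = 0 then 1 else u)
        (star (fun b : Fin 2 => if b = 0 then 1 else u)) +
      (((s + σ) / 2 : ℝ) : ℂ) • Matrix.vecMulVec (fun b : Fin 2 => if b = 0 then 1 else -u)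
        (star (fun b : Fin 2 => if b = 0 then 1 else -u)) := by
    ext a b
    fin_cases a <;> fin_cases b <;>
      simp [phaseFac, Matrix.vecMulVec_apply, bR_zero, bR_one, huu]
    · ring
    · linear_combination -hd'
    · linear_combination -hd
    · ring
  rw [this]
  refine ((Matrix.posSemidef_vecMulVec_self_star _).smul ?_).add
    ((Matrix.posSemidef_vecMulVec_self_star _).smul ?_)
  · exact Complex.zero_le_real.mpr (by linarith)
  · exact Complex.zero_le_real.mpr (by linarith)

theorem mixM_diff (h : ℕ) (s α α' : ℝ) (hs : |Real.sin ((α - α') / 2)| ≤ s) :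
    mixM h α - mixM h α' ≤ ((s / h : ℝ) : ℂ) • (1 : Matrix (Fin 2) (Fin 2) ℂ) := by
  rw [Matrix.le_iff]
  have : ((s / h : ℝ) : ℂ) • (1 : Matrix (Fin 2) (Fin 2) ℂ) - (mixM h α - mixM h α') =
      (h : ℂ)⁻¹ • ((s : ℂ) • (1 : Matrix (Fin 2) (Fin 2) ℂ) -
      (Matrix.of (phaseFac α) - Matrix.of (phaseFac α'))) := by
    rw [mixM_eq, mixM_eq]; push_cast
    rw [div_eq_inv_mul]
    module
  rw [this]
  exact (phase_diff s α α' hs).smul (hinv_nonneg h)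

theorem mixM_sum (h : ℕ) (δ : ℝ) :
    ∑ a, ∑ b, mixM h δ a b = ((2 * (1 - (h : ℝ)⁻¹ * Real.sin (δ / 2) ^ 2) : ℝ) : ℂ) := by
  simp only [Fin.sum_univ_two, mixM_apply, mixFac, phaseFac, bR_zero, bR_one]
  have h1 : Real.sin (δ / 2) ^ 2 = (1 - Real.cos δ) / 2 := by
    have := Real.cos_sq (δ / 2)
    have h2 := Real.sin_sq_add_cos_sq (δ / 2)
    have h3 : 2 * (δ / 2) = δ := by ring
    rw [h3] at this
    linarith
  rw [h1]
  have e1 : Complex.exp (Complex.I * ((δ * (1 - 0) : ℝ) : ℂ)) =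
      (Real.cos δ : ℂ) + (Real.sin δ : ℂ) * Complex.I := by
    rw [mul_comm, Complex.exp_mul_I]; push_cast; simp
  have e2 : Complex.exp (Complex.I * ((δ * (0 - 1) : ℝ) : ℂ)) =
      (Real.cos δ : ℂ) - (Real.sin δ : ℂ) * Complex.I := by
    rw [mul_comm, Complex.exp_mul_I]; push_cast; simp [sub_eq_add_neg]
  rw [e1, e2]
  simp
  ring

theorem alphaH_close (h : ℕ) (hh : 1 ≤ h) (α : ℝ) :
    |alphaH h α - α| ≤ Real.pi / (2 * h) := by
  have hp := Real.pi_pos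
  have hh' : (0 : ℝ) < h := by exact_mod_cast hh
  have h1 := Int.floor_le ((h : ℝ) * α / Real.pi + 1 / 2)
  have h2 := Int.lt_floor_add_one ((h : ℝ) * α / Real.pi + 1 / 2)
  unfold alphaH
  set j : ℝ := ((⌊(h : ℝ) * α / Real.pi + 1 / 2⌋ : ℤ) : ℝ)
  have e : α = ((h : ℝ) * α / Real.pi) * (Real.pi / h) := by field_simp
  set t := (h : ℝ) * α / Real.pi
  have hq : 0 < Real.pi / h := by positivity
  have e2 : j * Real.pi / h - α = (j - t) * (Real.pi / h) := by
    rw [e]; ring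
  have e3 : Real.pi / (2 * h) = 1 / 2 * (Real.pi / h) := by field_simp
  rw [e2, e3, abs_mul, abs_of_pos hq]
  refine mul_le_mul_of_nonneg_right ?_ hq.le
  rw [abs_le]; constructor <;> linarith

theorem sin_close (h : ℕ) (hh : 1 ≤ h) (δ : ℝ) (hδ : |δ| ≤ Real.pi / (2 * h)) :
    |Real.sin (δ / 2)| ≤ Real.sin (Real.pi / (4 * h)) := by
  have hp := Real.pi_pos
  have hh' : (1 : ℝ) ≤ h := by exact_mod_cast hh
  have h0 : Real.pi / (4 * h) ≤ Real.pi / 4 := by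
    apply div_le_div_of_nonneg_left hp.le (by norm_num); linarith
  have e : Real.pi / (2 * h) = 2 * (Real.pi / (4 * h)) := by field_simp; norm_num
  rw [e] at hδ
  obtain ⟨h1, h2⟩ := abs_le.mp hδ
  rw [abs_le]
  constructor
  · rw [← Real.sin_neg]
    apply Real.sin_le_sin_of_le_of_le_pi_div_two <;> linarith
  · apply Real.sin_le_sin_of_le_of_le_pi_div_two <;> linarith

/-! ### Block decomposition -/

/-- Representatives of bit strings off `A`. -/
def Zs {n : ℕ} (A : Finset (Fin n)) : Finset (QIdx n) :=
  Finset.univ.filter fun z => ∀ k ∈ A, z k = 0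

/-- Local factors of the block labelled by `z`. -/
def Fz {n : ℕ} (A : Finset (Fin n)) (f : Fin n → QIdx n → Matrix (Fin 2) (Fin 2) ℂ)
    (z : QIdx n) (k : Fin n) : Matrix (Fin 2) (Fin 2) ℂ :=
  if k ∈ A then f k z else Matrix.single (z k) (z k) 1

/-- Block-diagonal operator. -/
def blk {n : ℕ} (A : Finset (Fin n)) (f : Fin n → QIdx n → Matrix (Fin 2) (Fin 2) ℂ) : QOp n :=
  ∑ z ∈ Zs A, tens (Fz A f z)

theorem tens_Fz_apply {n : ℕ} (A : Finset (Fin n))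
    (f : Fin n → QIdx n → Matrix (Fin 2) (Fin 2) ℂ) (z x y : QIdx n) :
    tens (Fz A f z) x y = if (∀ j ∉ A, z j = x j ∧ z j = y j) then
      ∏ k ∈ A, f k z (x k) (y k) else 0 := by
  rw [tens_apply, ← Finset.prod_mul_prod_compl A]
  have e1 : ∏ k ∈ A, Fz A f z k (x k) (y k) = ∏ k ∈ A, f k z (x k) (y k) :=
    Finset.prod_congr rfl fun k hk => by simp [Fz, hk]
  rw [e1]
  split_ifs with H
  · rw [Finset.prod_eq_one (s := Aᶜ), mul_one]
    intro k hk
    have hk' : k ∉ A := by simpa using hk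
    simp only [Fz, hk', if_false, Matrix.single_apply]
    rw [if_pos (H k hk')]
  · push Not at H
    obtain ⟨j, hj, hz⟩ := H
    rw [Finset.prod_eq_zero (s := Aᶜ) (i := j) (by simpa using hj), mul_zero]
    simp only [Fz, hj, if_false, Matrix.single_apply]
    rw [if_neg]
    rintro ⟨a, b⟩
    exact hz a b

theorem blk_apply {n : ℕ} (A : Finset (Fin n))
    (f : Fin n → QIdx n → Matrix (Fin 2) (Fin 2) ℂ)
    (hf : ∀ k ∈ A, ∀ x z : QIdx n, (∀ j ∉ A, x j = z j) → f k x = f k z) (x y : QIdx n) :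
    blk A f x y = if ∀ j ∉ A, x j = y j then ∏ k ∈ A, f k x (x k) (y k) else 0 := by
  simp only [blk, Matrix.sum_apply, tens_Fz_apply]
  split_ifs with H
  · rw [Finset.sum_eq_single (fun k => if k ∈ A then 0 else x k)]
    · rw [if_pos]
      · refine Finset.prod_congr rfl fun k hk => ?_
        rw [hf k hk _ x]
        intro j hj; simp [hj]
      · intro j hj; simp [hj, H j hj]
    · intro z hz hne
      rw [if_neg]
      intro h
      apply hne
      funext k
      by_cases hk : k ∈ A
      · simp only [Zs, Finset.mem_filter] at hz
        simp [hk, hz.2 k hk]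
      · simp [hk, (h k hk).1]
    · intro h
      exfalso; apply h
      simp only [Zs, Finset.mem_filter, Finset.mem_univ, true_and]
      intro k hk; simp [hk]
  · apply Finset.sum_eq_zero
    intro z _
    rw [if_neg]
    intro h
    exact H fun j hj => (h j hj).1.symm.trans (h j hj).2

theorem blk_one {n : ℕ} (A : Finset (Fin n)) : blk A (fun _ _ => 1) = 1 := by
  ext x y
  rw [blk_apply _ _ (fun _ _ _ _ _ => rfl)]
  by_cases hxy : x = y
  · subst hxy; simp
  · rw [Matrix.one_apply_ne hxy]
    split_ifs with H
    · obtain ⟨k, hk⟩ := Function.ne_iff.mp hxy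
      have hkA : k ∈ A := by
        by_contra h; exact hk (H k h)
      exact Finset.prod_eq_zero hkA (Matrix.one_apply_ne hk)
    · rfl

theorem single_nonneg (b : Fin 2) : (0 : Matrix (Fin 2) (Fin 2) ℂ) ≤ Matrix.single b b 1 := by
  rw [Matrix.nonneg_iff_posSemidef]
  have : Matrix.single b b (1 : ℂ) = Matrix.vecMulVec (Pi.single b 1) (star (Pi.single b 1)) := by
    ext i j
    fin_cases b <;> fin_cases i <;> fin_cases j <;> simp [Matrix.vecMulVec_apply]
  rw [this]
  exact Matrix.posSemidef_vecMulVec_self_star _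

theorem blk_nonneg {n : ℕ} (A : Finset (Fin n))
    (f : Fin n → QIdx n → Matrix (Fin 2) (Fin 2) ℂ) (hf : ∀ k z, 0 ≤ f k z) :
    0 ≤ blk A f := by
  refine Finset.sum_nonneg fun z _ => ?_
  rw [Matrix.nonneg_iff_posSemidef]
  refine tens_nonneg _ fun k => ?_
  rw [← Matrix.nonneg_iff_posSemidef, Fz]
  split_ifs
  · exact hf k z
  · exact single_nonneg _

theorem blk_diff {n : ℕ} (A : Finset (Fin n))
    (f g : Fin n → QIdx n → Matrix (Fin 2) (Fin 2) ℂ) (c : ℝ) (hc : 0 ≤ c)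
    (hf : ∀ k z, 0 ≤ f k z) (hg : ∀ k z, 0 ≤ g k z)
    (hf1 : ∀ k z, f k z ≤ 1) (hg1 : ∀ k z, g k z ≤ 1)
    (hfg : ∀ k z, f k z - g k z ≤ (c : ℂ) • 1) :
    blk A f - blk A g ≤ (((A.card : ℝ) * c : ℝ) : ℂ) • 1 := by
  rw [← blk_one A]
  simp only [blk]
  rw [← Finset.sum_sub_distrib, Finset.smul_sum]
  refine Finset.sum_le_sum fun z _ => ?_
  have e : ((A.card : ℝ) * c) = ∑ k, if k ∈ A then c else 0 := by
    rw [Finset.sum_ite_mem]; simp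
  rw [e]
  refine tens_diff _ _ _ _ ?_ ?_ ?_ ?_ ?_ ?_
  · intro k; split_ifs
    · exact hc
    · exact le_rfl
  · intro k
    by_cases hk : k ∈ A
    · simp only [Fz, hk, if_true]
      exact hf k z
    · simp only [Fz, hk, if_false]
      exact single_nonneg _
  · intro k
    by_cases hk : k ∈ A
    · simp only [Fz, hk, if_true]
      exact hg k z
    · simp only [Fz, hk, if_false]
      exact single_nonneg _
  · intro k
    by_cases hk : k ∈ A
    · simp only [Fz, hk, if_true]
      exact hf1 k z
    · simp only [Fz, hk, if_false]
      exact le_rfl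
  · intro k
    by_cases hk : k ∈ A
    · simp only [Fz, hk, if_true]
      exact hg1 k z
    · simp only [Fz, hk, if_false]
      exact le_rfl
  · intro k
    by_cases hk : k ∈ A
    · simp only [Fz, hk, if_true]
      exact hfg k z
    · simp only [Fz, hk, if_false]
      simp

theorem blk_le_one {n : ℕ} (A : Finset (Fin n))
    (f : Fin n → QIdx n → Matrix (Fin 2) (Fin 2) ℂ) (hf : ∀ k z, 0 ≤ f k z)
    (hf1 : ∀ k z, f k z ≤ 1) : blk A f ≤ 1 := by
  rw [← blk_one A]
  simp only [blk]
  refine Finset.sum_le_sum fun z _ => tens_mono _ _ ?_ ?_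
  · intro k
    by_cases hk : k ∈ A
    · simp only [Fz, hk, if_true]
      exact hf k z
    · simp only [Fz, hk, if_false]
      exact single_nonneg _
  · intro k
    by_cases hk : k ∈ A
    · simp only [Fz, hk, if_true]
      exact hf1 k z
    · simp only [Fz, hk, if_false]
      exact le_rfl

theorem Zs_card {n : ℕ} (A : Finset (Fin n)) : (Zs A).card * 2 ^ A.card = 2 ^ n := by
  have h1 : (blk A (fun _ _ => 1)).trace = (2 : ℂ) ^ n := by
    rw [blk_one, Matrix.trace_one]; simp
  rw [blk, Matrix.trace_sum] at h1
  have h2 : ∀ z, (tens (Fz A (fun _ _ => 1) z)).trace = (2 : ℂ) ^ A.card := by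
    intro z
    rw [tens_trace]
    have : ∀ k, (Fz A (fun _ _ => 1) z k).trace = if k ∈ A then (2 : ℂ) else 1 := by
      intro k
      by_cases hk : k ∈ A
      · simp [Fz, hk]
      · simp [Fz, hk]
    rw [Finset.prod_congr rfl fun k _ => this k, Finset.prod_ite_mem]
    simp
  rw [Finset.sum_congr rfl fun z _ => h2 z] at h1
  simp only [Finset.sum_const, nsmul_eq_mul] at h1
  exact_mod_cast h1

theorem blk_mix_sum {n : ℕ} (A : Finset (Fin n)) (h : ℕ) (δ : Fin n → QIdx n → ℝ) (c : ℝ)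
    (hc0 : 0 ≤ c) (hc : ∀ k z, c ≤ 1 - (h : ℝ)⁻¹ * Real.sin (δ k z / 2) ^ 2) :
    ∃ r : ℝ, ∑ x, ∑ y, blk A (fun k z => mixM h (δ k z)) x y = (r : ℂ) ∧
      2 ^ n * c ^ A.card ≤ r := by
  refine ⟨∑ z ∈ Zs A, ∏ k ∈ A, 2 * (1 - (h : ℝ)⁻¹ * Real.sin (δ k z / 2) ^ 2), ?_, ?_⟩
  · simp only [blk, Matrix.sum_apply]
    rw [Complex.ofReal_sum]
    rw [Finset.sum_congr rfl (fun x _ => Finset.sum_comm), Finset.sum_comm]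
    refine Finset.sum_congr rfl fun z _ => ?_
    rw [tens_sum, ← Finset.prod_mul_prod_compl A, Finset.prod_eq_one (s := Aᶜ), mul_one,
      Complex.ofReal_prod]
    · refine Finset.prod_congr rfl fun k hk => ?_
      simp only [Fz, hk, if_true]
      rw [mixM_sum]
    · intro k hk
      have hk' : k ∉ A := by simpa using hk
      simp only [Fz, hk', if_false]
      generalize z k = b
      fin_cases b <;> simp only [Fin.sum_univ_two, Matrix.single_apply] <;> simp
  · have e : (2 : ℝ) ^ n * c ^ A.card = ∑ z ∈ Zs A, ∏ k ∈ A, (2 * c) := by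
      have := Zs_card A
      have h2 : ((Zs A).card : ℝ) * 2 ^ A.card = 2 ^ n := by exact_mod_cast this
      rw [← h2]; simp [mul_pow]; ring
    rw [e]
    refine Finset.sum_le_sum fun z _ => Finset.prod_le_prod (fun k _ => by linarith) fun k _ => ?_
    have := hc k z
    linarith

/-! ### The graph state -/

/-- Phase exponent of the graph state. -/
def gPhi (n : ℕ) (θ : Fin n → Fin n → ℝ) (z : QIdx n) : ℝ :=
  1 / 2 * ∑ j, ∑ k, θ j k * bR (z j) * bR (z k)

/-- Phase of the graph state. -/
def gPh (n : ℕ) (θ : Fin n → Fin n → ℝ) (z : QIdx n) : ℂ :=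
  Complex.exp (Complex.I * (gPhi n θ z : ℂ))

theorem gPh_mul_star (n : ℕ) (θ : Fin n → Fin n → ℝ) (x y : QIdx n) :
    gPh n θ x * star (gPh n θ y) = Complex.exp (Complex.I * ((gPhi n θ x - gPhi n θ y : ℝ) : ℂ)) := by
  rw [gPh, gPh, Complex.star_def, exp_conj_I, ← Complex.exp_add]
  congr 1; push_cast; ring

theorem gVec_mul_star (n : ℕ) (θ : Fin n → Fin n → ℝ) (x y : QIdx n) :
    gVec n θ x * star (gVec n θ y) = (1 / 2 : ℂ) ^ n * (gPh n θ x * star (gPh n θ y)) := by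
  have e : ∀ z, gVec n θ z = (((Real.sqrt (2 ^ n))⁻¹ : ℝ) : ℂ) * gPh n θ z := fun z => rfl
  rw [e, e]
  simp only [star_mul', Complex.star_def, Complex.conj_ofReal]
  have h1 : (((Real.sqrt (2 ^ n))⁻¹ : ℝ) : ℂ) * (((Real.sqrt (2 ^ n))⁻¹ : ℝ) : ℂ) =
      (1 / 2 : ℂ) ^ n := by
    rw [← Complex.ofReal_mul, ← mul_inv, Real.mul_self_sqrt (by positivity)]
    push_cast; simp
  rw [← h1]; ring

theorem gPhi_diff (n : ℕ) (θ : Fin n → Fin n → ℝ) (hsym : ∀ j k, θ j k = θ k j)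
    (A : Finset (Fin n)) (hA : ∀ j ∈ A, ∀ k ∈ A, θ j k = 0) (x y : QIdx n)
    (hxy : ∀ j ∉ A, x j = y j) :
    gPhi n θ x - gPhi n θ y = ∑ k ∈ A, alphaAngle n θ k x * (bR (x k) - bR (y k)) := by
  have h1 : ∑ k ∈ A, alphaAngle n θ k x * (bR (x k) - bR (y k)) =
      ∑ k, alphaAngle n θ k x * (bR (x k) - bR (y k)) := by
    refine Finset.sum_subset (Finset.subset_univ _) fun k _ hk => ?_
    rw [hxy k hk]; ring
  have h2 : ∑ k, alphaAngle n θ k x * (bR (x k) - bR (y k)) =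
      ∑ j, ∑ k, θ j k * bR (x j) * (bR (x k) - bR (y k)) := by
    rw [Finset.sum_comm]
    refine Finset.sum_congr rfl fun k _ => ?_
    rw [alphaAngle, Finset.sum_mul]
  have h3 : ∑ j, ∑ k, θ j k * bR (x j) * (bR (x k) - bR (y k)) =
      ∑ j, ∑ k, θ j k * bR (x k) * (bR (x j) - bR (y j)) := by
    rw [Finset.sum_comm]
    refine Finset.sum_congr rfl fun k _ => Finset.sum_congr rfl fun j _ => ?_
    rw [hsym j k]
  have h4 : (∑ j, ∑ k, θ j k * bR (x j) * bR (x k)) - ∑ j, ∑ k, θ j k * bR (y j) * bR (y k) =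
      (∑ j, ∑ k, θ j k * bR (x j) * (bR (x k) - bR (y k))) +
      ∑ j, ∑ k, θ j k * bR (x k) * (bR (x j) - bR (y j)) := by
    simp only [← Finset.sum_sub_distrib, ← Finset.sum_add_distrib]
    refine Finset.sum_congr rfl fun j _ => Finset.sum_congr rfl fun k _ => ?_
    have h5 : θ j k * (bR (x j) - bR (y j)) * (bR (x k) - bR (y k)) = 0 := by
      by_cases hj : j ∈ A
      · by_cases hk : k ∈ A
        · rw [hA j hj k hk]; ring
        · rw [hxy k hk]; ring
      · rw [hxy j hj]; ring
    linear_combination -h5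
  rw [h1, h2, gPhi, gPhi, ← mul_sub, h4, ← h3]; ring

theorem alpha_dep (n : ℕ) (θ : Fin n → Fin n → ℝ)
    (A : Finset (Fin n)) (hA : ∀ j ∈ A, ∀ k ∈ A, θ j k = 0) (k : Fin n) (hk : k ∈ A)
    (x z : QIdx n) (hxz : ∀ j ∉ A, x j = z j) : alphaAngle n θ k x = alphaAngle n θ k z := by
  refine Finset.sum_congr rfl fun j _ => ?_
  by_cases hj : j ∈ A
  · rw [hA j hj k hk]; ring
  · rw [hxz j hj]

theorem mixFac_shift (h : ℕ) (α γ : ℝ) (b b' : Fin 2) :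
    mixFac h (α + γ) b b' =
      Complex.exp (Complex.I * ((γ * (bR b - bR b') : ℝ) : ℂ)) * mixFac h α b b' := by
  unfold mixFac phaseFac
  by_cases hb : b = b'
  · subst hb; simp
  · have : Complex.exp (Complex.I * (((α + γ) * (bR b - bR b') : ℝ) : ℂ)) =
        Complex.exp (Complex.I * ((γ * (bR b - bR b') : ℝ) : ℂ)) *
        Complex.exp (Complex.I * ((α * (bR b - bR b') : ℝ) : ℂ)) := by
      rw [← Complex.exp_add]; congr 1; push_cast; ring
    rw [this]; simp [hb]; ring

theorem PBarH_eq (n : ℕ) (θ : Fin n → Fin n → ℝ) (h : ℕ)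
    (A : Finset (Fin n)) (hA : ∀ j ∈ A, ∀ k ∈ A, θ j k = 0) :
    PBarH n θ h A = blk A (fun k z => mixM h (alphaH h (alphaAngle n θ k z))) := by
  ext x y
  rw [blk_apply]
  · rfl
  · intro k hk x z hxz
    rw [alpha_dep n θ A hA k hk x z hxz]

theorem PBar_eq (n : ℕ) (θ : Fin n → Fin n → ℝ) (h : ℕ)
    (A : Finset (Fin n)) (hA : ∀ j ∈ A, ∀ k ∈ A, θ j k = 0) :
    PBar n θ (fun _ => h) A = blk A (fun k z => mixM h (alphaAngle n θ k z)) := by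
  ext x y
  rw [blk_apply]
  · rfl
  · intro k hk x z hxz
    rw [alpha_dep n θ A hA k hk x z hxz]

/-- Phase-shift identity in product form. -/
theorem gPh_prod (n : ℕ) (θ : Fin n → Fin n → ℝ) (hsym : ∀ j k, θ j k = θ k j)
    (A : Finset (Fin n)) (hA : ∀ j ∈ A, ∀ k ∈ A, θ j k = 0) (x y : QIdx n)
    (hxy : ∀ j ∉ A, x j = y j) : gPh n θ x * star (gPh n θ y) =
      ∏ k ∈ A, Complex.exp (Complex.I * ((alphaAngle n θ k x * (bR (x k) - bR (y k)) : ℝ) : ℂ)) := by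
  rw [gPh_mul_star, gPhi_diff n θ hsym A hA x y hxy, ← Complex.exp_sum, ← Finset.mul_sum,
    Complex.ofReal_sum]

theorem gPh_unit (n : ℕ) (θ : Fin n → Fin n → ℝ) (x : QIdx n) :
    gPh n θ x * star (gPh n θ x) = 1 := by
  rw [gPh_mul_star]; simp

theorem gVec_unit (n : ℕ) (θ : Fin n → Fin n → ℝ) : (gProj n θ).trace = 1 := by
  simp only [Matrix.trace, Matrix.diag_apply, gProj, Matrix.vecMulVec_apply, Pi.star_apply,
    gVec_mul_star, gPh_unit]
  simp

theorem PBarH_exp (n : ℕ) (θ : Fin n → Fin n → ℝ) (hsym : ∀ j k, θ j k = θ k j)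
    (A : Finset (Fin n)) (hA : ∀ j ∈ A, ∀ k ∈ A, θ j k = 0) (h : ℕ) (hh : 1 ≤ h) :
    ∃ r : ℝ, (PBarH n θ h A * gProj n θ).trace = (r : ℂ) ∧
      (1 - (h : ℝ)⁻¹ * Real.sin (Real.pi / (4 * h)) ^ 2) ^ A.card ≤ r := by
  set δ : Fin n → QIdx n → ℝ :=
    fun k z => alphaH h (alphaAngle n θ k z) - alphaAngle n θ k z with hδ
  have hh' : (1 : ℝ) ≤ h := by exact_mod_cast hh
  have hi0 : 0 ≤ (h : ℝ)⁻¹ := by positivity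
  have hi1 : (h : ℝ)⁻¹ ≤ 1 := inv_le_one_of_one_le₀ hh'
  have hs := Real.sin_sq_le_one (Real.pi / (4 * h))
  obtain ⟨r, hr, hle⟩ := blk_mix_sum A h δ (1 - (h : ℝ)⁻¹ * Real.sin (Real.pi / (4 * h)) ^ 2)
    (by nlinarith [sq_nonneg (Real.sin (Real.pi / (4 * h)))]) (by
      intro k z
      have h1 := sin_close h hh (δ k z) (alphaH_close h hh _)
      have h2 : Real.sin (δ k z / 2) ^ 2 ≤ Real.sin (Real.pi / (4 * h)) ^ 2 := by
        rw [← sq_abs (Real.sin (δ k z / 2))]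
        exact pow_le_pow_left₀ (abs_nonneg _) h1 2
      have := mul_le_mul_of_nonneg_left h2 hi0
      linarith)
  refine ⟨(1 / 2) ^ n * r, ?_, ?_⟩
  · push_cast
    rw [← hr, Finset.mul_sum]
    simp only [Matrix.trace, Matrix.diag_apply, Matrix.mul_apply]
    refine Finset.sum_congr rfl fun x _ => ?_
    rw [Finset.mul_sum]
    refine Finset.sum_congr rfl fun y _ => ?_
    rw [blk_apply]
    · simp only [PBarH, Matrix.of_apply, gProj, Matrix.vecMulVec_apply, Pi.star_apply,
        gVec_mul_star]
      split_ifs with H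
      · have e1 : gPh n θ y * star (gPh n θ x) = 
            ∏ k ∈ A, Complex.exp (Complex.I *
              ((-alphaAngle n θ k x * (bR (x k) - bR (y k)) : ℝ) : ℂ)) := by
          rw [gPh_prod n θ hsym A hA y x (fun j hj => (H j hj).symm)]
          refine Finset.prod_congr rfl fun k hk => ?_
          rw [alpha_dep n θ A hA k hk y x (fun j hj => (H j hj).symm)]
          congr 3; ring
        rw [e1]
        have e2 : ∏ k ∈ A, mixM h (δ k x) (x k) (y k) = 
            (∏ k ∈ A, Complex.exp (Complex.I *
              ((-alphaAngle n θ k x * (bR (x k) - bR (y k)) : ℝ) : ℂ))) *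
            ∏ k ∈ A, mixFac h (alphaH h (alphaAngle n θ k x)) (x k) (y k) := by
          rw [← Finset.prod_mul_distrib]
          refine Finset.prod_congr rfl fun k hk => ?_
          rw [mixM_apply, ← mixFac_shift]
          simp only [hδ, sub_eq_add_neg]
        rw [e2]; ring
      · simp
    · intro k hk x z hxz
      simp only [hδ]
      rw [alpha_dep n θ A hA k hk x z hxz]
  · have : (1 / 2 : ℝ) ^ n * 2 ^ n = 1 := by rw [← mul_pow]; norm_num
    calc (1 - (h : ℝ)⁻¹ * Real.sin (Real.pi / (4 * h)) ^ 2) ^ A.card 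
        = (1 / 2 : ℝ) ^ n * (2 ^ n * (1 - (h : ℝ)⁻¹ * Real.sin (Real.pi / (4 * h)) ^ 2) ^ A.card) := by
          rw [← mul_assoc, this, one_mul]
      _ ≤ _ := mul_le_mul_of_nonneg_left hle (by positivity)

/-- Unnormalized Hadamard matrix. -/
def Had : Matrix (Fin 2) (Fin 2) ℂ := !![1, 1; 1, -1]

theorem had_spec (n : ℕ) (e : Fin n → Fin 2 → ℝ) (M : Fin n → Matrix (Fin 2) (Fin 2) ℂ)
    (hM : ∀ k, M k = Had * Matrix.diagonal (fun b => ((1 / 2 * e k b : ℝ) : ℂ)) * Hadᴴ) :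
    tens M = tens (fun _ : Fin n => Had) * Matrix.diagonal (fun x : QIdx n =>
      (((1 / 2) ^ n * ∏ k, e k (x k) : ℝ) : ℂ)) * (tens (fun _ : Fin n => Had))ᴴ := by
  have : M = fun k => Had * Matrix.diagonal (fun b => ((1 / 2 * e k b : ℝ) : ℂ)) * Hadᴴ :=
    funext hM
  rw [this, tens_spec (fun _ => Had)]
  congr 2
  congr 1
  funext x
  rw [← Complex.ofReal_prod, Finset.prod_mul_distrib]
  simp

theorem had_diag (a b : ℂ) : Had * Matrix.diagonal (fun i : Fin 2 => if i = 0 then a else b) * Hadᴴ =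
    !![a + b, a - b; a - b, a + b] := by
  ext i j
  rw [Matrix.mul_apply]
  simp only [Matrix.mul_diagonal, Fin.sum_univ_two, Matrix.conjTranspose_apply]
  fin_cases i <;> fin_cases j <;> simp [Had] <;> ring

theorem had_mix (h : ℕ) : mixM h 0 = Had * Matrix.diagonal
    (fun b => ((1 / 2 * (if b = 0 then 1 else 1 - (h : ℝ)⁻¹) : ℝ) : ℂ)) * Hadᴴ := by
  have := had_diag (1 / 2) (1 / 2 * (1 - (h : ℂ)⁻¹))
  have e : (fun b : Fin 2 => ((1 / 2 * (if b = 0 then 1 else 1 - (h : ℝ)⁻¹) : ℝ) : ℂ)) =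
      fun i : Fin 2 => if i = 0 then (1 / 2 : ℂ) else 1 / 2 * (1 - (h : ℂ)⁻¹) := by
    funext b; split_ifs <;> push_cast <;> ring
  rw [e, this]
  ext i j
  fin_cases i <;> fin_cases j <;> simp [mixM, mixFac, phaseFac] <;> ring

theorem had_one : (1 : Matrix (Fin 2) (Fin 2) ℂ) = Had * Matrix.diagonal
    (fun _ => ((1 / 2 * 1 : ℝ) : ℂ)) * Hadᴴ := by
  have := had_diag (1 / 2) (1 / 2)
  have e : (fun _ : Fin 2 => ((1 / 2 * 1 : ℝ) : ℂ)) =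
      fun i : Fin 2 => if i = 0 then (1 / 2 : ℂ) else 1 / 2 := by
    funext b; simp
  rw [e, this]
  ext i j
  fin_cases i <;> fin_cases j <;> norm_num

theorem had_plus : Matrix.of (phaseFac 0) = Had * Matrix.diagonal
    (fun b => ((1 / 2 * (if b = 0 then 1 else 0) : ℝ) : ℂ)) * Hadᴴ := by
  have := had_diag (1 / 2) 0
  have e : (fun b : Fin 2 => ((1 / 2 * (if b = 0 then 1 else 0) : ℝ) : ℂ)) =
      fun i : Fin 2 => if i = 0 then (1 / 2 : ℂ) else 0 := by
    funext b; split_ifs <;> simp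
  rw [e, this]
  ext i j
  fin_cases i <;> fin_cases j <;> simp [phaseFac]

/-- The diagonal phase unitary. -/
def Dg (n : ℕ) (θ : Fin n → Fin n → ℝ) : QOp n := Matrix.diagonal (gPh n θ)

theorem Dg_conj_apply (n : ℕ) (θ : Fin n → Fin n → ℝ) (M : QOp n) (x y : QIdx n) :
    (Dg n θ * M * (Dg n θ)ᴴ) x y = (gPh n θ x * star (gPh n θ y)) * M x y := by
  rw [Dg, Matrix.diagonal_conjTranspose, Matrix.mul_diagonal, Matrix.diagonal_mul, Pi.star_apply]
  ring

theorem Dg_one (n : ℕ) (θ : Fin n → Fin n → ℝ) :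
    (1 : QOp n) = Dg n θ * tens (fun _ => 1) * (Dg n θ)ᴴ := by
  ext x y
  rw [Dg_conj_apply, tens_one]
  by_cases hxy : x = y
  · subst hxy; rw [gPh_unit]; simp
  · simp [hxy]

theorem Dg_gProj (n : ℕ) (θ : Fin n → Fin n → ℝ) :
    gProj n θ = Dg n θ * tens (fun _ => Matrix.of (phaseFac 0)) * (Dg n θ)ᴴ := by
  ext x y
  rw [Dg_conj_apply, gProj, Matrix.vecMulVec_apply, Pi.star_apply, gVec_mul_star, tens_apply]
  simp [phaseFac]; ring

theorem Dg_PBar (n : ℕ) (θ : Fin n → Fin n → ℝ) (hsym : ∀ j k, θ j k = θ k j)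
    (A : Finset (Fin n)) (hA : ∀ j ∈ A, ∀ k ∈ A, θ j k = 0) (h : ℕ) :
    PBar n θ (fun _ => h) A =
      Dg n θ * tens (fun k => if k ∈ A then mixM h 0 else 1) * (Dg n θ)ᴴ := by
  ext x y
  rw [Dg_conj_apply, tens_apply, ← Finset.prod_mul_prod_compl A]
  have e1 : ∏ k ∈ A, (if k ∈ A then mixM h 0 else 1) (x k) (y k) =
      ∏ k ∈ A, mixFac h 0 (x k) (y k) :=
    Finset.prod_congr rfl fun k hk => by simp [hk, mixM_apply]
  rw [e1, PBar, Matrix.of_apply]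
  split_ifs with H
  · rw [Finset.prod_eq_one (s := Aᶜ), mul_one, gPh_prod n θ hsym A hA x y H,
      ← Finset.prod_mul_distrib]
    · refine Finset.prod_congr rfl fun k hk => ?_
      rw [← mixFac_shift, zero_add]
    · intro k hk
      have hk' : k ∉ A := by simpa using hk
      simp only [hk', if_false]
      rw [H k hk']
      exact Matrix.one_apply_eq _
  · push Not at H
    obtain ⟨j, hj, hz⟩ := H
    rw [Finset.prod_eq_zero (s := Aᶜ) (i := j) (by simpa using hj), mul_zero, mul_zero]
    simp [hj, hz]

theorem gap (n m : ℕ) (θ : Fin n → Fin n → ℝ) (hsym : ∀ j k, θ j k = θ k j)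
    (A : Fin m → Finset (Fin n)) (hA : ∀ l, ∀ j ∈ A l, ∀ k ∈ A l, θ j k = 0)
    (hcover : ∀ v : Fin n, ∃ l, v ∈ A l) (h : ℕ) (hh : 1 ≤ h) :
    (gProj n θ - 1 + (h : ℂ) • ∑ l, (1 - PBar n θ (fun _ => h) (A l))).PosSemidef := by
  set W : QOp n := Dg n θ * tens (fun _ : Fin n => Had) with hW
  have cv : ∀ (e : Fin n → Fin 2 → ℝ) (M : Fin n → Matrix (Fin 2) (Fin 2) ℂ),
      (∀ k, M k = Had * Matrix.diagonal (fun b => ((1 / 2 * e k b : ℝ) : ℂ)) * Hadᴴ) →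
      Dg n θ * tens M * (Dg n θ)ᴴ = W * Matrix.diagonal (fun x : QIdx n =>
      (((1 / 2) ^ n * ∏ k, e k (x k) : ℝ) : ℂ)) * Wᴴ := by
    intro e M hM
    rw [had_spec n e M hM, hW, Matrix.conjTranspose_mul]
    simp only [Matrix.mul_assoc]
  have c1 : (1 : QOp n) = _ := (Dg_one n θ).trans (cv (fun _ _ => 1) _ (fun _ => had_one))
  have c2 : gProj n θ = _ :=
    (Dg_gProj n θ).trans (cv (fun _ b => if b = 0 then 1 else 0) _ (fun _ => had_plus))
  have c3 : ∀ l, PBar n θ (fun _ => h) (A l) = _ := fun l =>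
    (Dg_PBar n θ hsym (A l) (hA l) h).trans
      (cv (fun k b => if k ∈ A l then (if b = 0 then 1 else 1 - (h : ℝ)⁻¹) else 1) _ (fun k => by
        by_cases hk : k ∈ A l
        · simp only [hk, if_true]; exact had_mix h
        · simp only [hk, if_false]; exact had_one))
  have lin : ∀ (D1 D0 : QOp n) (D : Fin m → QOp n) (c : ℂ),
      W * D1 * Wᴴ - W * D0 * Wᴴ + c • ∑ l, (W * D0 * Wᴴ - W * D l * Wᴴ) =
        W * (D1 - D0 + c • ∑ l, (D0 - D l)) * Wᴴ := by
    intro D1 D0 D c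
    simp only [mul_add, add_mul, mul_sub, sub_mul, Finset.mul_sum, Finset.sum_mul,
      mul_smul_comm, smul_mul_assoc]
  have fin : gProj n θ - 1 + (h : ℂ) • ∑ l, (1 - PBar n θ (fun _ => h) (A l)) =
      W * Matrix.diagonal (fun x : QIdx n => (((1 / 2) ^ n * 
        ((∏ k, if x k = 0 then 1 else 0) - 1 + h * ∑ l, (1 - ∏ k,
          if k ∈ A l then (if x k = 0 then 1 else 1 - (h : ℝ)⁻¹) else 1)) : ℝ) : ℂ)) * Wᴴ := by
    rw [Finset.sum_congr rfl (fun l _ => by rw [c3 l]), c1, c2]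
    rw [lin]
    congr 2
    ext x y
    by_cases hxy : x = y
    · subst hxy
      simp only [Matrix.add_apply, Matrix.sub_apply, Matrix.smul_apply, Matrix.sum_apply,
        Matrix.diagonal_apply_eq, smul_eq_mul]
      rw [← Complex.ofReal_natCast]
      simp only [← Complex.ofReal_sub, ← Complex.ofReal_sum, ← Complex.ofReal_mul,
        ← Complex.ofReal_add]
      congr 1
      simp only [Finset.prod_const_one, mul_one]
      have : ∀ t : ℝ, (1 / 2 : ℝ) ^ n - (1 / 2) ^ n * t = (1 / 2) ^ n * (1 - t) := fun t => by ring
      simp only [this, ← Finset.mul_sum]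
      ring
    · simp [Matrix.sum_apply, hxy]
  rw [fin]
  refine Matrix.PosSemidef.mul_mul_conjTranspose_same ?_ _
  refine Matrix.PosSemidef.diagonal fun x => ?_
  refine Complex.zero_le_real.mpr (mul_nonneg (by positivity) ?_)
  have hh' : (1 : ℝ) ≤ h := by exact_mod_cast hh
  have hi0 : 0 ≤ (h : ℝ)⁻¹ := by positivity
  have hi1 : (h : ℝ)⁻¹ ≤ 1 := inv_le_one_of_one_le₀ hh'
  have f0 : ∀ l k, (0 : ℝ) ≤ if k ∈ A l then (if x k = 0 then 1 else 1 - (h : ℝ)⁻¹) else 1 := by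
    intro l k; split_ifs <;> linarith
  have f1 : ∀ l k, (if k ∈ A l then (if x k = 0 then 1 else 1 - (h : ℝ)⁻¹) else 1) ≤ (1 : ℝ) := by
    intro l k; split_ifs <;> linarith
  have f2 : ∀ l, (0 : ℝ) ≤ 1 - ∏ k,
      if k ∈ A l then (if x k = 0 then 1 else 1 - (h : ℝ)⁻¹) else 1 := fun l =>
    sub_nonneg.mpr (Finset.prod_le_one (fun k _ => f0 l k) fun k _ => f1 l k)
  by_cases hx : ∀ k, x k = 0
  · simp [hx]
  · push Not at hx
    obtain ⟨k, hk⟩ := hx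
    obtain ⟨l, hl⟩ := hcover k
    have g1 : (∏ k, if x k = 0 then (1 : ℝ) else 0) = 0 :=
      Finset.prod_eq_zero (Finset.mem_univ k) (by simp [hk])
    have g2 : (∏ k, if k ∈ A l then (if x k = 0 then 1 else 1 - (h : ℝ)⁻¹) else 1) ≤
        1 - (h : ℝ)⁻¹ := by
      rw [← Finset.mul_prod_erase _ _ (Finset.mem_univ k)]
      simp only [hl, hk, if_true, if_false]
      refine mul_le_of_le_one_right (by linarith) ?_
      exact Finset.prod_le_one (fun k _ => f0 l k) fun k _ => f1 l k
    have g3 := Finset.single_le_sum (fun l _ => f2 l) (Finset.mem_univ l)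
    have g4 : (h : ℝ)⁻¹ ≤ ∑ l, (1 - ∏ k,
          if k ∈ A l then (if x k = 0 then 1 else 1 - (h : ℝ)⁻¹) else 1) := by
      refine le_trans ?_ g3
      linarith
    have g5 : (h : ℝ) * (h : ℝ)⁻¹ = 1 := mul_inv_cancel₀ (by positivity)
    have g6 := mul_le_mul_of_nonneg_left g4 (by positivity : (0 : ℝ) ≤ h)
    rw [g1]
    linarith

/-! ### The test operator -/

theorem omega_psd (n m : ℕ) (θ : Fin n → Fin n → ℝ) (A : Fin m → Finset (Fin n))
    (hA : ∀ l, ∀ j ∈ A l, ∀ k ∈ A l, θ j k = 0) (h : ℕ) (hh : 1 ≤ h) :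
    (OmegaBarH n m θ h A).PosSemidef := by
  refine Matrix.PosSemidef.smul ?_ (hinv_nonneg m)
  refine Matrix.posSemidef_sum _ fun l _ => ?_
  rw [← Matrix.nonneg_iff_posSemidef, PBarH_eq n θ h (A l) (hA l)]
  exact blk_nonneg _ _ fun k z => mixM_nonneg h hh _

theorem one_sub_omega (n m : ℕ) (hm : 1 ≤ m) (θ : Fin n → Fin n → ℝ)
    (A : Fin m → Finset (Fin n)) (h : ℕ) :
    1 - OmegaBarH n m θ h A = (m : ℂ)⁻¹ • ∑ l, (1 - PBarH n θ h (A l)) := by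
  have hm' : (m : ℂ) ≠ 0 := by exact_mod_cast (by omega : m ≠ 0)
  rw [Finset.sum_sub_distrib, smul_sub, OmegaBarH]
  congr 1
  simp only [Finset.sum_const, Finset.card_univ, Fintype.card_fin]
  rw [← Nat.cast_smul_eq_nsmul ℂ, smul_smul, inv_mul_cancel₀ hm', one_smul]

theorem omega_le_one (n m : ℕ) (hm : 1 ≤ m) (θ : Fin n → Fin n → ℝ) (A : Fin m → Finset (Fin n))
    (hA : ∀ l, ∀ j ∈ A l, ∀ k ∈ A l, θ j k = 0) (h : ℕ) (hh : 1 ≤ h) :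
    (1 - OmegaBarH n m θ h A).PosSemidef := by
  rw [one_sub_omega n m hm]
  refine Matrix.PosSemidef.smul ?_ (hinv_nonneg m)
  refine Matrix.posSemidef_sum _ fun l _ => ?_
  rw [← Matrix.le_iff, PBarH_eq n θ h (A l) (hA l)]
  exact blk_le_one _ _ (fun k z => mixM_nonneg h hh _) fun k z => mixM_le_one h _

theorem key_ineq (n m : ℕ) (hm : 1 ≤ m) (θ : Fin n → Fin n → ℝ) (hsym : ∀ j k, θ j k = θ k j)
    (A : Fin m → Finset (Fin n)) (hA : ∀ l, ∀ j ∈ A l, ∀ k ∈ A l, θ j k = 0)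
    (hdisj : ∀ l l', l ≠ l' → Disjoint (A l) (A l'))
    (hcover : ∀ v : Fin n, ∃ l, v ∈ A l) (h : ℕ) (hh : 1 ≤ h) :
    (gProj n θ - ((1 - n * Real.sin (Real.pi / (4 * h)) - m * h : ℝ) : ℂ) • (1 : QOp n) -
      ((m * h : ℝ) : ℂ) • OmegaBarH n m θ h A).PosSemidef := by
  set s := Real.sin (Real.pi / (4 * h)) with hs
  have hh' : (0 : ℝ) < h := by exact_mod_cast hh
  have hm' : (m : ℂ) ≠ 0 := by exact_mod_cast (by omega : m ≠ 0)
  have hs0 : 0 ≤ s := le_trans (abs_nonneg _) (sin_close h hh 0 (by simp; positivity))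
  have hl : ∀ l, ((((A l).card : ℝ) * (s / h) : ℝ) : ℂ) • (1 : QOp n) -
      (PBarH n θ h (A l) - PBar n θ (fun _ => h) (A l)) |>.PosSemidef := by
    intro l
    rw [← Matrix.le_iff, PBarH_eq n θ h (A l) (hA l), PBar_eq n θ h (A l) (hA l)]
    refine blk_diff _ _ _ _ (by positivity) (fun k z => mixM_nonneg h hh _)
      (fun k z => mixM_nonneg h hh _) (fun k z => mixM_le_one h _) (fun k z => mixM_le_one h _) ?_
    intro k z
    exact mixM_diff h s _ _ (sin_close h hh _ (alphaH_close h hh _))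
  have hsum := (Matrix.posSemidef_sum Finset.univ fun l _ => hl l).smul
    (by exact_mod_cast Nat.zero_le h : (0 : ℂ) ≤ (h : ℂ))
  have hcard : ∑ l, ((A l).card : ℝ) = n := by
    have h1 : (Finset.univ.biUnion A) = Finset.univ := by
      ext v; simpa using hcover v
    have h2 := Finset.card_biUnion (s := Finset.univ) (t := A) fun l _ l' _ hne => hdisj l l' hne
    rw [h1] at h2
    simp only [Finset.card_univ, Fintype.card_fin] at h2
    exact_mod_cast h2.symm
  have htot := (gap n m θ hsym A hA hcover h hh).add hsum
  convert htot using 1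
  have e1 : ((m * h : ℝ) : ℂ) • OmegaBarH n m θ h A =
      ((m * h : ℝ) : ℂ) • (1 : QOp n) - (h : ℂ) • ∑ l, (1 - PBarH n θ h (A l)) := by
    have := one_sub_omega n m hm θ A h
    have e2 : OmegaBarH n m θ h A = 1 - (m : ℂ)⁻¹ • ∑ l, (1 - PBarH n θ h (A l)) := by
      rw [← this]; abel
    rw [e2, smul_sub, smul_smul]
    congr 2
    push_cast
    field_simp
  have e3 : ∑ l, ((((A l).card : ℝ) * (s / h) : ℝ) : ℂ) • (1 : QOp n) =
      ((n * (s / h) : ℝ) : ℂ) • (1 : QOp n) := by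
    rw [← Finset.sum_smul, ← Complex.ofReal_sum, ← Finset.sum_mul, hcard]
  have e4 : (h : ℂ) • ((n * (s / h) : ℝ) : ℂ) • (1 : QOp n) = ((n * s : ℝ) : ℂ) • (1 : QOp n) := by
    rw [smul_smul]; congr 1
    have : (h : ℂ) ≠ 0 := by exact_mod_cast (by omega : h ≠ 0)
    push_cast; field_simp
  rw [e1]
  simp only [Finset.sum_sub_distrib]
  rw [e3, smul_sub, smul_sub, smul_sub, smul_sub, e4]
  push_cast
  module

/-! ### Copies -/

theorem testAll_eq (n N : ℕ) (Ω : QOp n) (i : Fin (N + 1)) :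
    testAll n N Ω i = tens (Function.update (fun _ => Ω) i 1) := by
  ext x y
  rw [tens_update]
  rfl

theorem sum_update {ι κ : Type*} [Fintype ι] [DecidableEq ι] [Fintype κ] [DecidableEq κ]
    (i : ι) (y : ι → κ) (F : (ι → κ) → ℂ) :
    ∑ b, F (Function.update y i b) =
      ∑ x, (∏ j ∈ Finset.univ.erase i, if x j = y j then (1 : ℂ) else 0) * F x := by
  refine Finset.sum_of_injOn (fun b => Function.update y i b) ?_ ?_ ?_ ?_
  · intro a _ b _ hab
    have := congrFun hab i
    simpa using this
  · intro _ _; simp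
  · intro x _ hx
    have : ∃ j, j ≠ i ∧ x j ≠ y j := by
      by_contra hcon
      push Not at hcon
      apply hx
      refine ⟨x i, by simp, ?_⟩
      funext j
      rcases eq_or_ne j i with rfl | hj
      · simp
      · simp [Function.update_of_ne hj, hcon j hj]
    obtain ⟨j, hj, hne⟩ := this
    rw [Finset.prod_eq_zero (i := j) (by simp [hj]) (by simp [hne]), zero_mul]
  · intro b _
    rw [Finset.prod_eq_one, one_mul]
    intro j hj
    simp [Function.update_of_ne (Finset.ne_of_mem_erase hj)]

theorem ptrace_exp (n N : ℕ) (i : Fin (N + 1)) (g : QIdx n → ℂ)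
    (M : Matrix (BIdx n N) (BIdx n N) ℂ) :
    star g ⬝ᵥ (ptraceAt n N i M *ᵥ g) =
      (tens (Function.update (fun _ => 1) i (Matrix.vecMulVec g (star g))) * M).trace := by
  have hL : star g ⬝ᵥ (ptraceAt n N i M *ᵥ g) =
      ∑ x : BIdx n N, star (g (x i)) * ∑ b, M x (Function.update x i b) * g b := by
    simp only [dotProduct, Matrix.mulVec, ptraceAt, Matrix.of_apply, Pi.star_apply]
    simp only [Finset.sum_mul]
    have : ∀ a, ∑ b, ∑ x : BIdx n N, (if x i = a then M x (Function.update x i b) else 0) * g b =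
        ∑ x : BIdx n N, if x i = a then ∑ b, M x (Function.update x i b) * g b else 0 := by
      intro a
      rw [Finset.sum_comm]
      refine Finset.sum_congr rfl fun x _ => ?_
      split_ifs <;> simp
    simp only [this, Finset.mul_sum, mul_ite, mul_zero]
    rw [Finset.sum_comm]
    refine Finset.sum_congr rfl fun x _ => ?_
    simp
  rw [hL, Matrix.trace_mul_comm]
  simp only [Matrix.trace, Matrix.diag_apply, Matrix.mul_apply]
  refine Finset.sum_congr rfl fun x _ => ?_
  have := sum_update i x (fun y => M x y * g (y i))
  simp only [Function.update_self] at this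
  rw [this, Finset.mul_sum]
  refine Finset.sum_congr rfl fun y _ => ?_
  rw [tens_update, Matrix.vecMulVec_apply, Pi.star_apply]
  simp only [Matrix.one_apply]
  ring

theorem update_mul (n N : ℕ) (i : Fin (N + 1)) (Ω X : QOp n) :
    tens (Function.update (fun _ => 1) i X) * tens (Function.update (fun _ => Ω) i 1) =
      tens (Function.update (fun _ : Fin (N + 1) => Ω) i X) := by
  rw [tens_mul]
  congr 1
  funext k
  rcases eq_or_ne k i with rfl | hk
  · simp
  · simp [Function.update_of_ne hk]

theorem part_one (n m : ℕ) (hm : 1 ≤ m) (θ : Fin n → Fin n → ℝ) (hsym : ∀ j k, θ j k = θ k j)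
    (A : Fin m → Finset (Fin n)) (hA : ∀ l, ∀ j ∈ A l, ∀ k ∈ A l, θ j k = 0)
    (h : ℕ) (hh : 1 ≤ h) (N : ℕ) :
    (1 - (h : ℝ)⁻¹ * Real.sin (Real.pi / (4 * h)) ^ 2) ^
        (N * Finset.univ.sup fun l => (A l).card) ≤
      acceptProb n N (OmegaBarH n m θ h A) (iidState n N θ) := by
  set c := 1 - (h : ℝ)⁻¹ * Real.sin (Real.pi / (4 * h)) ^ 2 with hc
  set K := Finset.univ.sup fun l => (A l).card with hK
  have hh' : (1 : ℝ) ≤ h := by exact_mod_cast hh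
  have hi0 : 0 ≤ (h : ℝ)⁻¹ := by positivity
  have hi1 : (h : ℝ)⁻¹ ≤ 1 := inv_le_one_of_one_le₀ hh'
  have hs := Real.sin_sq_le_one (Real.pi / (4 * h))
  have hs0 := sq_nonneg (Real.sin (Real.pi / (4 * h)))
  have hc0 : 0 ≤ c := by nlinarith
  have hc1 : c ≤ 1 := by nlinarith
  choose r hr hcr using fun l => PBarH_exp n θ hsym (A l) (hA l) h hh
  set R : ℝ := (m : ℝ)⁻¹ * ∑ l, r l with hR
  have hm0 : (0 : ℝ) < m := by exact_mod_cast hm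
  have hRc : c ^ K ≤ R := by
    have h1 : ∀ l, c ^ K ≤ r l := fun l =>
      (pow_le_pow_of_le_one hc0 hc1 (Finset.le_sup (f := fun l => (A l).card)
        (Finset.mem_univ l))).trans (hcr l)
    have h2 : (m : ℝ) * c ^ K ≤ ∑ l, r l := by
      have := Finset.sum_le_sum fun l (_ : l ∈ (Finset.univ : Finset (Fin m))) => h1 l
      simpa using this
    rw [hR, inv_mul_eq_div, le_div_iff₀ hm0]
    linarith
  have hΩ : (OmegaBarH n m θ h A * gProj n θ).trace = (R : ℂ) := by
    rw [OmegaBarH, smul_mul_assoc, Matrix.trace_smul, Finset.sum_mul, Matrix.trace_sum,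
      Finset.sum_congr rfl fun l _ => hr l, hR]
    push_cast; rfl
  have hiid : iidState n N θ = tens (fun _ => gProj n θ) := rfl
  have ht : ∀ i, (testAll n N (OmegaBarH n m θ h A) i * iidState n N θ).trace = ((R ^ N : ℝ) : ℂ) := by
    intro i
    rw [testAll_eq, hiid, tens_mul, tens_trace, ← Finset.mul_prod_erase _ _ (Finset.mem_univ i)]
    have : ∀ k ∈ Finset.univ.erase i, (Function.update (fun _ => OmegaBarH n m θ h A) i 1 k *
        gProj n θ).trace = (R : ℂ) := by
      intro k hk
      rw [Function.update_of_ne (Finset.ne_of_mem_erase hk), hΩ]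
    rw [Finset.prod_congr rfl this]
    simp [gVec_unit]
  rw [acceptProb, Finset.sum_congr rfl fun i _ => ht i]
  have e : (((N : ℂ) + 1)⁻¹ * ∑ _i : Fin (N + 1), ((R ^ N : ℝ) : ℂ)) = ((R ^ N : ℝ) : ℂ) := by
    have : ((N : ℂ) + 1) ≠ 0 := by exact_mod_cast Nat.succ_ne_zero N
    simp only [Finset.sum_const, Finset.card_univ, Fintype.card_fin, nsmul_eq_mul]
    push_cast
    field_simp
  rw [e, Complex.ofReal_re, mul_comm, pow_mul]
  exact pow_le_pow_left₀ (pow_nonneg hc0 _) hRc N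

theorem part_two (n m : ℕ) (hm : 1 ≤ m) (θ : Fin n → Fin n → ℝ) (hsym : ∀ j k, θ j k = θ k j)
    (A : Fin m → Finset (Fin n)) (hA : ∀ l, ∀ j ∈ A l, ∀ k ∈ A l, θ j k = 0)
    (hdisj : ∀ l l', l ≠ l' → Disjoint (A l) (A l'))
    (hcover : ∀ v : Fin n, ∃ l, v ∈ A l) (h : ℕ) (hh : 1 ≤ h) (N : ℕ) (hN : 1 ≤ N)
    (β : ℝ) (hβ0 : 0 < β) (ρ : Matrix (BIdx n N) (BIdx n N) ℂ) (hρ : ρ.PosSemidef)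
    (hρ1 : ρ.trace = 1) (hp : β ≤ acceptProb n N (OmegaBarH n m θ h A) ρ) :
    1 - ((m : ℝ) * h * (1 - β) / (β * N) + (n : ℝ) * Real.sin (Real.pi / (4 * h))) ≤
        (star (gVec n θ) ⬝ᵥ (condState n N (OmegaBarH n m θ h A) ρ *ᵥ gVec n θ)).re := by
  set s := Real.sin (Real.pi / (4 * h)) with hs
  set Ω := OmegaBarH n m θ h A with hΩ
  have hΩ0 : Ω.PosSemidef := omega_psd n m θ A hA h hh
  have hΩ1 : (1 - Ω).PosSemidef := omega_le_one n m hm θ A hA h hh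
  set E : Fin (N + 1) → QOp n → ℝ :=
    fun i X => (tens (Function.update (fun _ : Fin (N + 1) => Ω) i X) * ρ).trace.re with hE
  set q : ℝ := (tens (fun _ : Fin (N + 1) => Ω) * ρ).trace.re with hq
  set p := acceptProb n N Ω ρ with hpdef
  have hN0 : (0 : ℝ) < N := by exact_mod_cast hN
  have hN1 : ((N : ℝ) + 1) ≠ 0 := by positivity
  have hEq : ∀ i, E i Ω = q := by
    intro i
    simp only [hE, hq]
    rw [Function.update_eq_self_iff.mpr rfl]
  have hp1 : ((N : ℝ) + 1) * p = ∑ i, E i 1 := by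
    rw [hpdef, acceptProb]
    have : ((N : ℂ) + 1)⁻¹ = ((((N : ℝ) + 1)⁻¹ : ℝ) : ℂ) := by push_cast; rfl
    rw [this, Complex.re_ofReal_mul, ← mul_assoc, mul_inv_cancel₀ hN1, one_mul, Complex.re_sum]
    refine Finset.sum_congr rfl fun i _ => ?_
    rw [testAll_eq]
  have hF : (star (gVec n θ) ⬝ᵥ (condState n N Ω ρ *ᵥ gVec n θ)).re =
      (((N : ℝ) + 1) * p)⁻¹ * ∑ i, E i (gProj n θ) := by
    rw [condState, ← hpdef, Matrix.smul_mulVec, dotProduct_smul, smul_eq_mul, ← Complex.ofReal_inv,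
      Complex.re_ofReal_mul, Matrix.sum_mulVec, dotProduct_sum, Complex.re_sum]
    congr 1
    refine Finset.sum_congr rfl fun i _ => ?_
    rw [ptrace_exp, testAll_eq, ← mul_assoc, update_mul]
    rfl
  have hlow : ∀ i, (1 - n * s - m * h) * E i 1 + (m * h) * q ≤ E i (gProj n θ) := by
    intro i
    have hk := key_ineq n m hm θ hsym A hA hdisj hcover h hh
    rw [← hs, ← hΩ] at hk
    have h1 : (tens (Function.update (fun _ : Fin (N + 1) => Ω) i
        (gProj n θ - ((1 - n * s - m * h : ℝ) : ℂ) • (1 : QOp n) -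
          ((m * h : ℝ) : ℂ) • Ω))).PosSemidef := by
      refine tens_nonneg _ fun j => ?_
      rcases eq_or_ne j i with rfl | hj
      · rw [Function.update_self]; exact hk
      · rw [Function.update_of_ne hj]; exact hΩ0
    have h2 := trace_mul_re_nonneg h1 hρ
    rw [tens_update_sub, tens_update_sub, tens_update_smul, tens_update_smul, sub_mul, sub_mul,
      smul_mul_assoc, smul_mul_assoc, Matrix.trace_sub, Matrix.trace_sub, Matrix.trace_smul,
      Matrix.trace_smul, smul_eq_mul, smul_eq_mul, Complex.sub_re, Complex.sub_re,
      Complex.re_ofReal_mul, Complex.re_ofReal_mul] at h2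
    have h3 := hEq i
    simp only [hE] at h3 ⊢
    rw [h3] at h2
    linarith
  have hsum := Finset.sum_le_sum fun i (_ : i ∈ (Finset.univ : Finset (Fin (N + 1)))) => hlow i
  rw [Finset.sum_add_distrib, ← Finset.mul_sum, ← hp1] at hsum
  simp only [Finset.sum_const, Finset.card_univ, Fintype.card_fin, nsmul_eq_mul] at hsum
  push_cast at hsum
  have hti : ((N : ℝ) + 1) * p ≤ 1 + N * q := by
    have h1 := trace_mul_re_nonneg (tens_ineq (ι := Fin (N + 1)) Ω hΩ0 hΩ1) hρ
    have e : ((Fintype.card (Fin (N + 1)) : ℂ) - 1) = ((N : ℝ) : ℂ) := by simp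
    rw [e, sub_mul, add_mul, one_mul, smul_mul_assoc, Finset.sum_mul, Matrix.trace_sub,
      Matrix.trace_add, Matrix.trace_smul, Matrix.trace_sum, hρ1, smul_eq_mul, Complex.sub_re,
      Complex.add_re, Complex.re_ofReal_mul, Complex.re_sum, Complex.one_re] at h1
    rw [hp1]
    linarith
  have hp0 : 0 < p := lt_of_lt_of_le hβ0 hp
  have hpq : p - q ≤ p * ((1 - β) / (β * N)) := by
    have h1 : p - q ≤ (1 - p) / N := by
      rw [le_div_iff₀ hN0]; linarith
    have h2 : (1 - p) / N ≤ p * ((1 - β) / (β * N)) := by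
      rw [← mul_div_assoc, div_le_div_iff₀ hN0 (by positivity)]
      nlinarith
    exact h1.trans h2
  rw [hF, inv_mul_eq_div, le_div_iff₀ (by positivity)]
  refine le_trans ?_ hsum
  have hmh : (0 : ℝ) ≤ m * h := by positivity
  have h5 := mul_le_mul_of_nonneg_left hpq hmh
  have h6 := mul_le_mul_of_nonneg_left h5 (by positivity : (0 : ℝ) ≤ (N : ℝ) + 1)
  have e7 : (m : ℝ) * h * (1 - β) / (β * N) = m * h * ((1 - β) / (β * N)) := by ring
  rw [e7]
  set t := (1 - β) / (β * N)
  linarith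

end Helpers

/-- Theorem 4 of the paper (non-adaptive protocol with imperfect match): the i.i.d. state
`(|G⟩⟨G|)^{⊗(N+1)}` passes the `N`-random sampling test of `Ω̄_h(𝒜)` with probability at
least `(1 - (1/h) sin²(π/4h))^{N·max_l |A_l|}`, and for `β ≥ 1/(N+1)` any state passing
with probability `≥ β` leaves a conditional state `σ` with
`⟨G|σ|G⟩ ≥ 1 - [mh(1-β)/(βN) + n sin(π/4h)]`. -/
theorem nonadaptive_imperfect_match
    (n m : ℕ) (hn : 1 ≤ n) (hm : 1 ≤ m)
    (G : SimpleGraph (Fin n)) (θ : Fin n → Fin n → ℝ)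
    (hsym : ∀ j k, θ j k = θ k j)
    (hθ : ∀ j k, ¬ G.Adj j k → θ j k = 0)
    (A : Fin m → Finset (Fin n))
    (hdisj : ∀ l l', l ≠ l' → Disjoint (A l) (A l'))
    (hcover : ∀ v : Fin n, ∃ l, v ∈ A l)
    (hne : ∀ l, (A l).Nonempty)
    (hind : ∀ l, ∀ j ∈ A l, ∀ k ∈ A l, ¬ G.Adj j k)
    (h : ℕ) (hh : 1 ≤ h) (N : ℕ) (hN : 1 ≤ N)
    (β : ℝ) (hβ0 : 0 < β) (hβ1 : β ≤ 1) (hβ : 1 / ((N : ℝ) + 1) ≤ β) :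
    (1 - (h : ℝ)⁻¹ * Real.sin (Real.pi / (4 * h)) ^ 2) ^
        (N * Finset.univ.sup fun l => (A l).card) ≤
      acceptProb n N (OmegaBarH n m θ h A) (iidState n N θ) ∧
    ∀ ρ : Matrix (BIdx n N) (BIdx n N) ℂ, ρ.PosSemidef → ρ.trace = 1 →
      β ≤ acceptProb n N (OmegaBarH n m θ h A) ρ →
      1 - ((m : ℝ) * h * (1 - β) / (β * N) + (n : ℝ) * Real.sin (Real.pi / (4 * h))) ≤
        (star (gVec n θ) ⬝ᵥ (condState n N (OmegaBarH n m θ h A) ρ *ᵥ gVec n θ)).re := by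
  have hA : ∀ l, ∀ j ∈ A l, ∀ k ∈ A l, θ j k = 0 :=
    fun l j hj k hk => hθ j k (hind l j hj k hk)
  exact ⟨part_one n m hm θ hsym A hA h hh N, fun ρ hρ hρ1 hp =>
    part_two n m hm θ hsym A hA hdisj hcover h hh N hN β hβ0 ρ hρ hρ1 hp⟩

end
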